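/- arXiv:1208.1822 — 2 statements merged into one kernel-verified Lean document; each statement's English description precedes it below -/
import Mathlib

section
/- Let J ⊊ I be squarefree monomial ideals of S = K[x_1,…,x_n], generated by monomials of degrees ≥ d and ≥ d+1 respectively, and let ρ_j(I∖J) be the number of squarefree monomials of degree j in I∖J. If depth_S(I/J) ≥ d+2, then 2ρ_d(I) ≤ ρ_{d+1}(I∖J) ≤ ρ_d(I) + ρ_{d+2}(I∖J). In particular, if ρ_{d+2}(I∖J) = 0 then ρ_d(I) = ρ_{d+1}(I∖J) = 0. -/
noncomputable section

open MvPolynomial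

/-- The total degree of an exponent vector. -/
def edeg {n : ℕ} (a : Fin n →₀ ℕ) : ℕ := ∑ i, a i

/-- An exponent vector is squarefree if every exponent is at most 1. -/
def IsSqfree {n : ℕ} (a : Fin n →₀ ℕ) : Prop := ∀ i, a i ≤ 1

/-- The set of exponent vectors of monomials belonging to the ideal `I`. -/
def expSet {K : Type} [Field K] {n : ℕ} (I : Ideal (MvPolynomial (Fin n) K)) :
    Set (Fin n →₀ ℕ) := {a | (monomial a (1 : K)) ∈ I}

/-- `I` is generated by monomials `x^a` with `a` satisfying the predicate `P`. -/
def GenBy {K : Type} [Field K] {n : ℕ} (I : Ideal (MvPolynomial (Fin n) K))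
    (P : (Fin n →₀ ℕ) → Prop) : Prop :=
  ∃ G : Set (Fin n →₀ ℕ), (∀ a ∈ G, P a) ∧
    I = Ideal.span ((fun a => (monomial a (1 : K))) '' G)

/-- `I` is a monomial ideal. -/
def IsMonomialIdeal {K : Type} [Field K] {n : ℕ} (I : Ideal (MvPolynomial (Fin n) K)) : Prop :=
  GenBy I fun _ => True

/-- `I` is a squarefree monomial ideal. -/
def IsSqfreeMonomialIdeal {K : Type} [Field K] {n : ℕ}
    (I : Ideal (MvPolynomial (Fin n) K)) : Prop := GenBy I IsSqfree

/-- `x^a >_lex x^b` in the lexicographic order with `x_1 > x_2 > ⋯ > x_n`. -/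
def lexGT {n : ℕ} (a b : Fin n →₀ ℕ) : Prop :=
  ∃ i : Fin n, (∀ j : Fin n, j < i → a j = b j) ∧ b i < a i

/-- `I` is a lexsegment ideal. -/
def IsLexsegment {K : Type} [Field K] {n : ℕ} (I : Ideal (MvPolynomial (Fin n) K)) : Prop :=
  IsMonomialIdeal I ∧ ∀ a b : Fin n →₀ ℕ, (monomial a (1 : K)) ∈ I → edeg b = edeg a →
    lexGT b a → (monomial b (1 : K)) ∈ I

/-- `I` is a squarefree lexsegment ideal. -/
def IsSqfreeLexsegment {K : Type} [Field K] {n : ℕ}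
    (I : Ideal (MvPolynomial (Fin n) K)) : Prop :=
  IsSqfreeMonomialIdeal I ∧ ∀ a b : Fin n →₀ ℕ, IsSqfree a → IsSqfree b →
    (monomial a (1 : K)) ∈ I → edeg b = edeg a → lexGT b a → (monomial b (1 : K)) ∈ I

/-- The minimal number of generators of an ideal. -/
def mu {K : Type} [Field K] {n : ℕ} (I : Ideal (MvPolynomial (Fin n) K)) : ℕ :=
  sInf {m | ∃ G : Finset (MvPolynomial (Fin n) K), G.card = m ∧ I = Ideal.span (G : Set _)}

/-- `ξ_k = ∑_{j=1}^k C(2j-1, j)`. -/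
def xi (k : ℕ) : ℕ := ∑ j ∈ Finset.Icc 1 k, (2 * j - 1).choose j

/-- The Hilbert function of `I`: the `K`-dimension of the degree-`j` component of `I`. -/
def hilb {K : Type} [Field K] {n : ℕ} (I : Ideal (MvPolynomial (Fin n) K)) (j : ℕ) : ℕ :=
  Module.finrank K ↥((Submodule.restrictScalars K I) ⊓ homogeneousSubmodule (Fin n) K j)

/-- The Hilbert function of `I` extended to all integer degrees. -/
def hilbZ {K : Type} [Field K] {n : ℕ} (I : Ideal (MvPolynomial (Fin n) K)) (j : ℤ) : ℕ :=
  if 0 ≤ j then hilb I j.toNat else 0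

/-- The Hilbert function of a standard graded polynomial ring in `d` variables,
at degree `t ∈ ℤ`. -/
def polyHilb (d : ℕ) (t : ℤ) : ℕ :=
  if t < 0 then 0 else if d = 0 then (if t = 0 then 1 else 0) else (t.toNat + (d - 1)).choose (d - 1)

/-- A (standard graded) Hilbert decomposition of `I` all of whose retracts are polynomial
rings in at least `k` variables: `I ≅ ⊕ᵢ Sᵢ(-sᵢ)` as graded `K`-vector spaces, where `Sᵢ`
is a graded algebra retract of `S`, i.e. a polynomial ring in `dd i ≥ k` variables. -/
def HilbertDecomp1 {K : Type} [Field K] {n : ℕ} (I : Ideal (MvPolynomial (Fin n) K))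
    (k : ℕ) : Prop :=
  ∃ (ι : Type) (_ : Fintype ι) (dd : ι → ℕ) (s : ι → ℤ),
    (∀ i, k ≤ dd i) ∧ ∀ j : ℤ, hilbZ I j = ∑ i, polyHilb (dd i) (j - s i)

/-- The Hilbert depth of `I` in the standard graded sense. -/
def hdepth1 {K : Type} [Field K] {n : ℕ} (I : Ideal (MvPolynomial (Fin n) K)) : ℕ∞ :=
  sSup {k : ℕ∞ | ∃ m : ℕ, HilbertDecomp1 I m ∧ k = m}

/-- The set of exponent vectors `u + ℕ^Z`, corresponding to the Stanley space `x^u K[Z]`. -/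
def cone {n : ℕ} (u : Fin n →₀ ℕ) (Z : Finset (Fin n)) : Set (Fin n →₀ ℕ) :=
  {a | (∀ j, u j ≤ a j) ∧ ∀ j ∉ Z, a j = u j}

/-- A Stanley decomposition, with all Stanley spaces of dimension at least `k`, of the
`ℤⁿ`-graded module whose monomial basis has exponent set `A`. -/
def StanleyPartN {n : ℕ} (A : Set (Fin n →₀ ℕ)) (k : ℕ) : Prop :=
  ∃ (ι : Type) (_ : Fintype ι) (u : ι → (Fin n →₀ ℕ)) (Z : ι → Finset (Fin n)),
    (∀ i, k ≤ (Z i).card) ∧ (∀ i, cone (u i) (Z i) ⊆ A) ∧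
    (∀ a ∈ A, ∃! i, a ∈ cone (u i) (Z i))

/-- The multigraded Stanley depth of the `ℤⁿ`-graded module whose monomial basis has
exponent set `A`. -/
def sdepthN {n : ℕ} (A : Set (Fin n →₀ ℕ)) : ℕ∞ :=
  sSup {k : ℕ∞ | ∃ m : ℕ, StanleyPartN A m ∧ k = m}

/-- A multigraded Hilbert decomposition of the monomial ideal `I`, with all retracts
polynomial rings in at least `k` variables: the multigraded Hilbert function of `I`
(which takes values 0 and 1) equals the sum of the multigraded Hilbert functions of
the shifted retracts `x^{u i} K[Z i]`. -/
def HilbertDecompN {K : Type} [Field K] {n : ℕ} (I : Ideal (MvPolynomial (Fin n) K))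
    (k : ℕ) : Prop :=
  ∃ (ι : Type) (_ : Fintype ι) (u : ι → (Fin n →₀ ℕ)) (Z : ι → Finset (Fin n)),
    (∀ i, k ≤ (Z i).card) ∧
    (∀ a : Fin n →₀ ℕ, (a ∈ expSet I ↔ ∃ i, a ∈ cone (u i) (Z i)) ∧
      (∀ i i', a ∈ cone (u i) (Z i) → a ∈ cone (u i') (Z i') → i = i'))

/-- The multigraded Hilbert depth of a monomial ideal `I`. -/
def hdepthN {K : Type} [Field K] {n : ℕ} (I : Ideal (MvPolynomial (Fin n) K)) : ℕ∞ :=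
  sSup {k : ℕ∞ | ∃ m : ℕ, HilbertDecompN I m ∧ k = m}

/-- The graded maximal ideal `(x_1, …, x_n)`. -/
def maxIdeal (K : Type) [Field K] (n : ℕ) : Ideal (MvPolynomial (Fin n) K) :=
  Ideal.span (Set.range X)

/-- The depth of a module `M` over `S = K[x_1,…,x_n]` with respect to the graded maximal
ideal: the supremum of lengths of `M`-regular sequences in `(x_1,…,x_n)`. -/
def mdepth (K : Type) [Field K] (n : ℕ) (M : Type)
    [AddCommGroup M] [Module (MvPolynomial (Fin n) K) M] : ℕ∞ :=
  sSup {k : ℕ∞ | ∃ rs : List (MvPolynomial (Fin n) K),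
    (∀ r ∈ rs, r ∈ maxIdeal K n) ∧ RingTheory.Sequence.IsRegular M rs ∧ k = rs.length}

/-- The quotient module `I/J` for ideals `J ≤ I`. -/
def quotMod {K : Type} [Field K] {n : ℕ} (I J : Ideal (MvPolynomial (Fin n) K)) : Type :=
  ↥I ⧸ (Submodule.comap (Submodule.subtype I) J)

instance {K : Type} [Field K] {n : ℕ} (I J : Ideal (MvPolynomial (Fin n) K)) :
    AddCommGroup (quotMod I J) := by unfold quotMod; infer_instance

instance {K : Type} [Field K] {n : ℕ} (I J : Ideal (MvPolynomial (Fin n) K)) :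
    Module (MvPolynomial (Fin n) K) (quotMod I J) := by unfold quotMod; infer_instance

/-- `ρ_j(I\J)`: the number of squarefree monomials of degree `j` in `I ∖ J`. -/
def rho {K : Type} [Field K] {n : ℕ} (I J : Ideal (MvPolynomial (Fin n) K)) (j : ℕ) : ℕ :=
  Set.ncard {a : Fin n →₀ ℕ | IsSqfree a ∧ edeg a = j ∧ a ∈ expSet I ∧ a ∉ expSet J}

/-- `ρ_j(I)`: the number of squarefree monomials of degree `j` in `I`. -/
def rhoI {K : Type} [Field K] {n : ℕ} (I : Ideal (MvPolynomial (Fin n) K)) (j : ℕ) : ℕ :=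
  Set.ncard {a : Fin n →₀ ℕ | IsSqfree a ∧ edeg a = j ∧ a ∈ expSet I}

/-- `I` is a stable monomial ideal. Here `j` plays the role of `m(u)`, the largest index of
a variable dividing `u = x^a`. -/
def IsStable {K : Type} [Field K] {n : ℕ} (I : Ideal (MvPolynomial (Fin n) K)) : Prop :=
  IsMonomialIdeal I ∧ ∀ a : Fin n →₀ ℕ, (monomial a (1 : K)) ∈ I →
    ∀ j : Fin n, a j ≠ 0 → (∀ l, j < l → a l = 0) → ∀ i, i < j →
      (monomial (a + Finsupp.single i 1 - Finsupp.single j 1) (1 : K)) ∈ I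

/-- `I` is a squarefree stable monomial ideal. -/
def IsSqfreeStable {K : Type} [Field K] {n : ℕ} (I : Ideal (MvPolynomial (Fin n) K)) : Prop :=
  IsSqfreeMonomialIdeal I ∧ ∀ a : Fin n →₀ ℕ, IsSqfree a → (monomial a (1 : K)) ∈ I →
    ∀ j : Fin n, a j ≠ 0 → (∀ l, j < l → a l = 0) → ∀ i, i < j → a i = 0 →
      (monomial (a + Finsupp.single i 1 - Finsupp.single j 1) (1 : K)) ∈ I

/-- `I` is a squarefree strongly stable monomial ideal. -/
def IsSqfreeStronglyStable {K : Type} [Field K] {n : ℕ}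
    (I : Ideal (MvPolynomial (Fin n) K)) : Prop :=
  IsSqfreeMonomialIdeal I ∧ ∀ a : Fin n →₀ ℕ, IsSqfree a → (monomial a (1 : K)) ∈ I →
    ∀ i : Fin n, a i ≠ 0 → ∀ j, j < i → a j = 0 →
      (monomial (a + Finsupp.single j 1 - Finsupp.single i 1) (1 : K)) ∈ I

/-- The exponent vectors of the minimal monomial generators of a monomial ideal:
the monomials of `I` minimal with respect to divisibility. -/
def minGens {K : Type} [Field K] {n : ℕ} (I : Ideal (MvPolynomial (Fin n) K)) :
    Set (Fin n →₀ ℕ) := {a | a ∈ expSet I ∧ ∀ b ∈ expSet I, b ≤ a → b = a}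

/-- `m(u)`: the largest index (1-based) of a variable dividing `x^a`; `0` if `a = 0`. -/
def mvar {n : ℕ} (a : Fin n →₀ ℕ) : ℕ := a.support.sup (fun i => (i : ℕ) + 1)

/-- `m(I) = max { m(u) : u ∈ G(I) }`. -/
def mIdeal {K : Type} [Field K] {n : ℕ} (I : Ideal (MvPolynomial (Fin n) K)) : ℕ :=
  sSup {m | ∃ a ∈ minGens I, m = mvar a}

open MvPolynomial

/-- The `K`-subspace `Aᵢ·xᵢ` of `S`, where `Aᵢ` is the subalgebra generated by `B`. -/
def stSpace {K : Type} [Field K] {n : ℕ} (B : Finset (MvPolynomial (Fin n) K))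
    (x : MvPolynomial (Fin n) K) : Submodule K (MvPolynomial (Fin n) K) :=
  (Subalgebra.toSubmodule (Algebra.adjoin K (B : Set (MvPolynomial (Fin n) K)))).map
    (LinearMap.mulLeft K x)

/-- A standard graded Stanley decomposition of the ideal `I` with all Stanley spaces of
depth at least `k`: a finite family of graded algebra retracts `Sᵢ = K[Bᵢ]` (generated by
`k ≤ |Bᵢ|` linearly independent linear forms) and homogeneous elements `xᵢ ∈ I` with
`Sᵢ ∩ ann(xᵢ) = 0`, such that `I = ⊕ᵢ Sᵢ xᵢ` as graded `K`-vector spaces. -/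
def StanleyDecomp1 {K : Type} [Field K] {n : ℕ} (I : Ideal (MvPolynomial (Fin n) K))
    (k : ℕ) : Prop :=
  ∃ (ι : Type) (_ : Fintype ι) (B : ι → Finset (MvPolynomial (Fin n) K))
    (x : ι → MvPolynomial (Fin n) K) (d : ι → ℕ),
      (∀ i, ∀ b ∈ B i, b ∈ homogeneousSubmodule (Fin n) K 1) ∧
      (∀ i, LinearIndependent K (fun b : (B i : Set (MvPolynomial (Fin n) K)) =>
        (b : MvPolynomial (Fin n) K))) ∧
      (∀ i, k ≤ (B i).card) ∧
      (∀ i, x i ∈ I) ∧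
      (∀ i, x i ∈ homogeneousSubmodule (Fin n) K (d i)) ∧
      (∀ i, ∀ a ∈ Algebra.adjoin K ((B i : Set (MvPolynomial (Fin n) K))),
        a * x i = 0 → a = 0) ∧
      (iSup (fun i => stSpace (B i) (x i)) = Submodule.restrictScalars K I) ∧
      (iSupIndep fun i => stSpace (B i) (x i))

/-- The standard graded Stanley depth of `I`. -/
def sdepth1 {K : Type} [Field K] {n : ℕ} (I : Ideal (MvPolynomial (Fin n) K)) : ℕ∞ :=
  sSup {k : ℕ∞ | ∃ m : ℕ, StanleyDecomp1 I m ∧ k = m}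

/-- The subspace `S₁ · V` of `S`. -/
def mulS1 {K : Type} [Field K] {n : ℕ} (V : Submodule K (MvPolynomial (Fin n) K)) :
    Submodule K (MvPolynomial (Fin n) K) :=
  Submodule.span K {p | ∃ l ∈ homogeneousSubmodule (Fin n) K 1, ∃ v ∈ V, p = l * v}

/-- A lexsegment set of monomials of degree `d`. -/
def IsLexSet {n : ℕ} (d : ℕ) (L : Set (Fin n →₀ ℕ)) : Prop :=
  (∀ a ∈ L, edeg a = d) ∧ ∀ a ∈ L, ∀ b : Fin n →₀ ℕ, edeg b = d → lexGT b a → b ∈ L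

/-- `V ⊆ S_d` is a Gotzmann space: `dim_K (S₁·V) = dim_K (S₁·lex(V))`, where `lex(V)` is
spanned by the lexsegment set of monomials of degree `d` of cardinality `dim_K V`. -/
def IsGotzmannSpace {K : Type} [Field K] {n : ℕ} (d : ℕ)
    (V : Submodule K (MvPolynomial (Fin n) K)) : Prop :=
  ∃ L : Finset (Fin n →₀ ℕ), IsLexSet (n := n) d (L : Set (Fin n →₀ ℕ)) ∧ L.card = Module.finrank K ↥V ∧
    Module.finrank K ↥(mulS1 V) =
      Module.finrank K ↥(mulS1 (Submodule.span K
        ((fun a => (monomial a (1 : K))) '' (L : Set (Fin n →₀ ℕ)))))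

/-- `I` is a homogeneous ideal in the standard grading. -/
def IsHomogeneousIdeal {K : Type} [Field K] {n : ℕ}
    (I : Ideal (MvPolynomial (Fin n) K)) : Prop :=
  ∀ p ∈ I, ∀ k : ℕ, homogeneousComponent k p ∈ I

/-- `I` is a Gotzmann ideal: each homogeneous component `I_k` is a Gotzmann space. -/
def IsGotzmannIdeal {K : Type} [Field K] {n : ℕ}
    (I : Ideal (MvPolynomial (Fin n) K)) : Prop :=
  IsHomogeneousIdeal I ∧ ∀ k : ℕ,
    IsGotzmannSpace k ((Submodule.restrictScalars K I) ⊓ homogeneousSubmodule (Fin n) K k)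

/-- `I` is generated by homogeneous elements of degree `d`. -/
def GenInDegHomog {K : Type} [Field K] {n : ℕ} (I : Ideal (MvPolynomial (Fin n) K))
    (d : ℕ) : Prop :=
  ∃ G : Set (MvPolynomial (Fin n) K), (∀ g ∈ G, g ∈ homogeneousSubmodule (Fin n) K d) ∧
    I = Ideal.span G

section Koszul

open scoped Pointwise

variable {S : Type} [CommRing S] {n : ℕ}

/-- The sign of moving `e_i` past the elements of `F` smaller than `i`. -/
def koszulSign (i : Fin n) (F : Finset (Fin n)) : ℤ := (-1) ^ (F.filter (· < i)).card

lemma koszulSign_mul_self (i : Fin n) (F : Finset (Fin n)) :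
    koszulSign i F * koszulSign i F = 1 := by
  unfold koszulSign
  rw [← mul_pow]; simp

lemma koszulSign_erase_self (i : Fin n) (F : Finset (Fin n)) :
    koszulSign i (F.erase i) = koszulSign i F := by
  unfold koszulSign
  congr 2
  ext j
  simp only [Finset.mem_filter, Finset.mem_erase]
  grind

lemma koszulSign_insert_self (i : Fin n) (F : Finset (Fin n)) :
    koszulSign i (insert i F) = koszulSign i F := by
  unfold koszulSign
  congr 2
  ext j
  simp only [Finset.mem_filter, Finset.mem_insert]
  grind

lemma koszulSign_erase_of_lt {i j : Fin n} (h : j < i) {F : Finset (Fin n)} (hj : j ∈ F) :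
    koszulSign i (F.erase j) = -koszulSign i F := by
  unfold koszulSign
  have h1 : (F.filter (· < i)).card = ((F.erase j).filter (· < i)).card + 1 := by
    rw [Finset.filter_erase, Finset.card_erase_add_one]
    simp [hj, h]
  rw [h1, pow_succ]; ring

lemma koszulSign_erase_of_gt {i j : Fin n} (h : i < j) (F : Finset (Fin n)) :
    koszulSign i (F.erase j) = koszulSign i F := by
  unfold koszulSign
  congr 2
  ext k
  simp only [Finset.mem_filter, Finset.mem_erase]
  grind

lemma koszulSign_mul_erase {i j : Fin n} (h : i ≠ j) {F : Finset (Fin n)} (hi : i ∈ F)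
    (hj : j ∈ F) :
    koszulSign i F * koszulSign j (F.erase i) = -(koszulSign j F * koszulSign i (F.erase j)) := by
  rcases lt_or_gt_of_ne h with h | h
  · rw [koszulSign_erase_of_lt h hi, koszulSign_erase_of_gt h]; ring
  · rw [koszulSign_erase_of_lt h hj, koszulSign_erase_of_gt h]; ring

lemma koszulSign_mul_insert {i j : Fin n} (h : i ≠ j) {F : Finset (Fin n)} (hi : i ∉ F)
    (hj : j ∈ F) :
    koszulSign i F * koszulSign j (insert i F) =
      -(koszulSign j F * koszulSign i (F.erase j)) := by
  have h1 := koszulSign_mul_erase h (Finset.mem_insert_self i F) (Finset.mem_insert_of_mem hj)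
  rw [Finset.erase_insert hi, koszulSign_insert_self, Finset.erase_insert_of_ne h,
    koszulSign_insert_self] at h1
  have h2 := koszulSign_mul_self j F
  have h3 := koszulSign_mul_self j (insert i F)
  linear_combination (koszulSign j F * koszulSign j (insert i F)) * h1 -
    (koszulSign i F * koszulSign j (insert i F)) * h2 - (koszulSign j F * koszulSign i (F.erase j)) * h3

variable (S) (M : Type) [AddCommGroup M] [Module S M]

/-- Exterior multiplication by `e_i` on Koszul cochains. -/
def koszulWedge (i : Fin n) : (Finset (Fin n) → M) →ₗ[S] (Finset (Fin n) → M) where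
  toFun f F := if i ∈ F then koszulSign i F • f (F.erase i) else 0
  map_add' f g := by
    ext F
    by_cases h : i ∈ F <;> simp [h]
  map_smul' r f := by
    ext F
    by_cases h : i ∈ F <;> simp [h, smul_comm r]

/-- Contraction with `e_i` on Koszul cochains. -/
def koszulContract (i : Fin n) : (Finset (Fin n) → M) →ₗ[S] (Finset (Fin n) → M) where
  toFun f F := if i ∈ F then 0 else koszulSign i F • f (insert i F)
  map_add' f g := by
    ext F
    by_cases h : i ∈ F <;> simp [h]
  map_smul' r f := by
    ext F
    by_cases h : i ∈ F <;> simp [h, smul_comm r]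

variable {M}

lemma koszulWedge_apply (i : Fin n) (f : Finset (Fin n) → M) (F : Finset (Fin n)) :
    koszulWedge S M i f F = if i ∈ F then koszulSign i F • f (F.erase i) else 0 := rfl

lemma koszulContract_apply (i : Fin n) (f : Finset (Fin n) → M) (F : Finset (Fin n)) :
    koszulContract S M i f F = if i ∈ F then 0 else koszulSign i F • f (insert i F) := rfl

lemma koszulWedge_wedge (i j : Fin n) (f : Finset (Fin n) → M) :
    koszulWedge S M i (koszulWedge S M j f) = -koszulWedge S M j (koszulWedge S M i f) := by
  ext F
  rw [Pi.neg_apply]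
  simp only [koszulWedge_apply, Finset.mem_erase]
  by_cases hij : i = j
  · subst hij; simp
  · by_cases hi : i ∈ F <;> by_cases hj : j ∈ F <;> simp [hi, hj, hij, Ne.symm hij]
    rw [smul_smul, smul_smul, koszulSign_mul_erase hij hi hj, Finset.erase_right_comm, neg_smul]

lemma koszulContract_wedge (i j : Fin n) (f : Finset (Fin n) → M) :
    koszulContract S M i (koszulWedge S M j f) + koszulWedge S M j (koszulContract S M i f) =
      if i = j then f else 0 := by
  ext F
  rw [Pi.add_apply]
  simp only [koszulWedge_apply, koszulContract_apply, Finset.mem_erase, Finset.mem_insert]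
  by_cases hij : i = j
  · subst hij
    by_cases hi : i ∈ F
    · simp [hi, koszulSign_erase_self, smul_smul, koszulSign_mul_self, Finset.insert_erase]
    · simp [hi, koszulSign_insert_self, smul_smul, koszulSign_mul_self]
  · by_cases hi : i ∈ F <;> by_cases hj : j ∈ F <;> simp [hi, hj, hij, Ne.symm hij]
    rw [smul_smul, smul_smul, koszulSign_mul_insert hij hi hj, Finset.erase_insert_of_ne hij,
      neg_smul, neg_add_cancel]

variable {S}

/-- The Koszul differential `f ↦ (∑ x_i e_i) ∧ f`. -/
def koszulD (x : Fin n → S) (M : Type) [AddCommGroup M] [Module S M] :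
    (Finset (Fin n) → M) →ₗ[S] (Finset (Fin n) → M) :=
  ∑ i, x i • koszulWedge S M i

variable (x : Fin n → S)

lemma koszulD_apply (f : Finset (Fin n) → M) (F : Finset (Fin n)) :
    koszulD x M f F = ∑ i ∈ F, koszulSign i F • x i • f (F.erase i) := by
  simp only [koszulD, LinearMap.sum_apply, LinearMap.smul_apply, Finset.sum_apply, Pi.smul_apply,
    koszulWedge_apply, smul_ite, smul_zero]
  rw [← Finset.sum_filter]
  simp [smul_comm (x _)]

lemma koszulD_koszulD (f : Finset (Fin n) → M) : koszulD x M (koszulD x M f) = 0 := by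
  simp only [koszulD, LinearMap.sum_apply, LinearMap.smul_apply, map_sum, map_smul,
    Finset.smul_sum, smul_smul]
  rw [← Finset.sum_product']
  refine Finset.sum_ninvolution (fun p => (p.2, p.1)) ?_ ?_ ?_ ?_
  · rintro ⟨i, j⟩
    simp only
    rw [koszulWedge_wedge, mul_comm, smul_neg, neg_add_cancel]
  · rintro ⟨i, j⟩ h he
    apply h
    simp only [Prod.mk.injEq] at he
    obtain ⟨rfl, -⟩ := he
    have : koszulWedge S M j (koszulWedge S M j f) = 0 := by
      ext F
      simp [koszulWedge_apply]
    simp [this]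
  · simp
  · simp

lemma koszulD_contract (i : Fin n) (f : Finset (Fin n) → M) :
    koszulD x M (koszulContract S M i f) + koszulContract S M i (koszulD x M f) = x i • f := by
  simp only [koszulD, LinearMap.sum_apply, LinearMap.smul_apply, map_sum, map_smul]
  rw [← Finset.sum_add_distrib]
  simp only [← smul_add]
  rw [Finset.sum_eq_single i]
  · rw [add_comm, koszulContract_wedge, if_pos rfl]
  · intro j _ hj
    rw [add_comm, koszulContract_wedge, if_neg (Ne.symm hj), smul_zero]
  · simp

lemma koszulD_map {N : Type} [AddCommGroup N] [Module S N] (φ : M →ₗ[S] N)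
    (f : Finset (Fin n) → M) (F : Finset (Fin n)) :
    koszulD x N (fun G => φ (f G)) F = φ (koszulD x M f F) := by
  simp only [koszulD_apply, map_sum, map_zsmul, map_smul]

lemma koszulD_support {k : ℕ} {f : Finset (Fin n) → M} (hf : ∀ F, F.card + 1 ≠ k → f F = 0)
    (F : Finset (Fin n)) (hF : F.card ≠ k) : koszulD x M f F = 0 := by
  rw [koszulD_apply]
  refine Finset.sum_eq_zero fun i hi => ?_
  rw [hf, smul_zero, smul_zero]
  rwa [Finset.card_erase_add_one hi]

/-- Vanishing of the `k`-th Koszul cohomology of `M` with respect to `x`. -/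
def KoszulVanish (x : Fin n → S) (M : Type) [AddCommGroup M] [Module S M] (k : ℕ) : Prop :=
  ∀ f : Finset (Fin n) → M, (∀ F, F.card ≠ k → f F = 0) → koszulD x M f = 0 →
    ∃ g : Finset (Fin n) → M, (∀ F, F.card + 1 ≠ k → g F = 0) ∧ koszulD x M g = f

lemma eq_zero_of_koszulVanish_zero (h : KoszulVanish x M 0) {m : M} (hm : ∀ i, x i • m = 0) :
    m = 0 := by
  obtain ⟨g, hg, hgf⟩ := h (fun F => if F = ∅ then m else 0)
    (by intro F hF; simp at hF; simp [hF])
    (by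
      ext F
      rw [koszulD_apply]
      refine Finset.sum_eq_zero fun i _ => ?_
      split_ifs <;> simp [hm])
  have h0 : g = 0 := by ext F; exact hg F (by simp)
  have := congrFun hgf ∅
  simpa [h0, eq_comm] using this

/-- Lift of a cochain to `M` from a quotient, with the same support. -/
lemma exists_cochain_lift (N : Submodule S M) (P : Finset (Fin n) → Prop)
    (f : Finset (Fin n) → M ⧸ N) (hf : ∀ F, P F → f F = 0) :
    ∃ g : Finset (Fin n) → M, (∀ F, P F → g F = 0) ∧ ∀ F, N.mkQ (g F) = f F := by
  classical
  choose g hg using fun F => N.mkQ_surjective (f F)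
  refine ⟨fun F => if P F then 0 else g F, fun F hF => by simp [hF], fun F => ?_⟩
  by_cases hF : P F
  · simp [hF, hf F hF]
  · simp only [hF, if_false, hg]

/-- A cochain with values in `r • M` is `r` times a cochain with the same support. -/
lemma exists_cochain_smul (r : S) (P : Finset (Fin n) → Prop)
    (f : Finset (Fin n) → M) (hf : ∀ F, P F → f F = 0)
    (hr : ∀ F, (r • (⊤ : Submodule S M)).mkQ (f F) = 0) :
    ∃ g : Finset (Fin n) → M, (∀ F, P F → g F = 0) ∧ f = r • g := by
  classical
  have h1 : ∀ F, ∃ m, r • m = f F := fun F => by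
    have := hr F
    rw [Submodule.mkQ_apply, Submodule.Quotient.mk_eq_zero,
      Submodule.mem_smul_pointwise_iff_exists] at this
    obtain ⟨m, -, hm⟩ := this
    exact ⟨m, hm⟩
  choose g hg using h1
  refine ⟨fun F => if P F then 0 else g F, fun F hF => by simp [hF], ?_⟩
  ext F
  by_cases hF : P F
  · simp [hF, hf F hF]
  · simp [hF, hg]

theorem KoszulVanish.of_quotSMulTop {r : S} (hr : r ∈ Ideal.span (Set.range x))
    (hreg : IsSMulRegular M r) {T : ℕ} (h : ∀ k < T, KoszulVanish x (QuotSMulTop r M) k) :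
    ∀ k < T + 1, KoszulVanish x M k := by
  intro k hk z hz hdz
  obtain ⟨c, rfl⟩ := (Ideal.mem_span_range_iff_exists_fun).1 hr
  set r := ∑ i, c i * x i with hrdef
  set w := ∑ i, c i • koszulContract S M i z with hw
  have hdw : koszulD x M w = r • z := by
    rw [hw, map_sum, hrdef, Finset.sum_smul]
    refine Finset.sum_congr rfl fun i _ => ?_
    rw [map_smul, mul_smul, ← koszulD_contract x, hdz, map_zero, add_zero]
  have hws : ∀ F, F.card + 1 ≠ k → w F = 0 := by
    intro F hF
    rw [hw, Finset.sum_apply]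
    refine Finset.sum_eq_zero fun i _ => ?_
    rw [Pi.smul_apply, koszulContract_apply]
    split_ifs with hi
    · simp
    · rw [hz, smul_zero, smul_zero]
      rwa [Finset.card_insert_of_notMem hi]
  have hregf : ∀ f g : Finset (Fin n) → M, r • f = r • g → f = g := fun f g hfg => by
    ext F
    exact hreg (congrFun hfg F)
  rcases k with _ | k
  · refine ⟨0, by simp, ?_⟩
    have : w = 0 := by ext F; exact hws F (by simp)
    rw [map_zero]
    apply hregf
    rw [← hdw, this, smul_zero, map_zero]
  · have hmk : koszulD x (QuotSMulTop r M) (fun F => (r • (⊤ : Submodule S M)).mkQ (w F)) = 0 := by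
      ext F
      refine (koszulD_map x _ w F).trans ?_
      rw [hdw, Submodule.mkQ_apply]
      exact (Submodule.Quotient.mk_eq_zero _).2
        (Submodule.smul_mem_pointwise_smul _ _ _ Submodule.mem_top)
    obtain ⟨v', hv', hdv'⟩ := h k (by omega) _
      (fun F hF => by rw [hws F (by omega), map_zero]) hmk
    obtain ⟨v, hv, hvv⟩ := exists_cochain_lift (r • (⊤ : Submodule S M)) _ v' hv'
    have hvd : ∀ F, (r • (⊤ : Submodule S M)).mkQ ((w - koszulD x M v) F) = 0 := by
      intro F
      rw [Pi.sub_apply, map_sub, ← koszulD_map, sub_eq_zero]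
      simp only [hvv]
      exact (congrFun hdv' F).symm
    obtain ⟨u, hu, hwu⟩ := exists_cochain_smul r (fun F => F.card ≠ k) _
      (fun F hF => by
        rw [Pi.sub_apply, hws F (by omega), koszulD_support x hv F hF, sub_zero]) hvd
    refine ⟨u, fun F hF => hu F (by omega), hregf _ _ ?_⟩
    rw [← map_smul, ← hwu, map_sub, koszulD_koszulD, sub_zero, hdw]

theorem KoszulVanish.of_isWeaklyRegular (rs : List S) :
    ∀ (M : Type) [AddCommGroup M] [Module S M],
      (∀ r ∈ rs, r ∈ Ideal.span (Set.range x)) → RingTheory.Sequence.IsWeaklyRegular M rs →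
      ∀ k < rs.length, KoszulVanish x M k := by
  induction rs with
  | nil => intro M _ _ _ _ k hk; simp at hk
  | cons r rs ih =>
    intro M _ _ hmem hreg k hk
    rw [RingTheory.Sequence.isWeaklyRegular_cons_iff] at hreg
    exact KoszulVanish.of_quotSMulTop x (hmem r (by simp)) hreg.1
      (ih _ (fun s hs => hmem s (by simp [hs])) hreg.2) k (by simpa using hk)

theorem KoszulVanish.quotSMulTop {r : S} (hreg : IsSMulRegular M r) {k : ℕ}
    (h0 : KoszulVanish x M k) (h1 : KoszulVanish x M (k + 1)) :
    KoszulVanish x (QuotSMulTop r M) k := by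
  intro w' hw' hdw'
  obtain ⟨w, hw, hww⟩ := exists_cochain_lift (r • (⊤ : Submodule S M)) _ w' hw'
  have hdw : ∀ F, (r • (⊤ : Submodule S M)).mkQ (koszulD x M w F) = 0 := fun F => by
    rw [← koszulD_map]
    simp only [hww]
    exact congrFun hdw' F
  obtain ⟨z, hz, hdz⟩ := exists_cochain_smul r (fun F => F.card ≠ k + 1) _
    (fun F hF => koszulD_support x (fun F hF' => hw F (by omega)) F hF) hdw
  have hz0 : koszulD x M z = 0 := by
    have h2 := koszulD_koszulD x w
    rw [hdz, map_smul] at h2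
    ext F
    exact hreg (by simpa using congrFun h2 F)
  obtain ⟨v, hv, rfl⟩ := h1 z hz hz0
  obtain ⟨u, hu, hdu⟩ := h0 (w - r • v)
    (fun F hF => by
      rw [Pi.sub_apply, Pi.smul_apply, hw F hF, hv F (by omega), smul_zero, sub_zero])
    (by rw [map_sub, map_smul, hdz, sub_self])
  refine ⟨fun F => (r • (⊤ : Submodule S M)).mkQ (u F),
    fun F hF => by simp only [hu F hF, map_zero], ?_⟩
  ext F
  refine (koszulD_map x _ u F).trans ?_
  rw [hdu, Pi.sub_apply, map_sub, hww, sub_eq_self, Submodule.mkQ_apply]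
  exact (Submodule.Quotient.mk_eq_zero _).2
    (Submodule.smul_mem_pointwise_smul _ _ _ Submodule.mem_top)

end Koszul

section GenericLinearForm

open scoped Pointwise

variable {L S : Type} [Field L] [CommRing S] [Algebra L S] [IsNoetherianRing S] {n : ℕ}
  (x : Fin n → S)

/-- If no nonzero element of a finite module is killed by all `x_i`, then over an infinite field
some linear combination of the `x_i` is a nonzerodivisor on the module. -/
theorem exists_isSMulRegular_linearForm [Infinite L] (M : Type) [AddCommGroup M] [Module S M]
    [Module.Finite S M] (h : ∀ m : M, (∀ i, x i • m = 0) → m = 0) :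
    ∃ c : Fin n → L, IsSMulRegular M (∑ i, c i • x i) := by
  classical
  let φ : (Fin n → L) →ₗ[L] S := Fintype.linearCombination L x
  have hfin := associatedPrimes.finite S M
  let s : Finset (Subspace L (Fin n → L)) :=
    hfin.toFinset.image fun p => (p.restrictScalars L).comap φ
  have hs : ⊤ ∉ s := by
    intro htop
    obtain ⟨p, hp, hpt⟩ := Finset.mem_image.1 htop
    rw [Set.Finite.mem_toFinset, AssociatedPrimes.mem_iff, isAssociatedPrime_iff] at hp
    obtain ⟨hprime, m, rfl⟩ := hp
    have hm : m = 0 := by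
      refine h m fun i => ?_
      have h1 : Pi.single i (1 : L) ∈ (⊤ : Subspace L (Fin n → L)) := trivial
      rw [← hpt, Submodule.mem_comap, Fintype.linearCombination_apply_single, one_smul] at h1
      simpa [Submodule.mem_colon_singleton] using h1
    apply hprime.ne_top
    simp [hm]
  have hne := Subspace.biUnion_ne_univ_of_top_notMem hs
  obtain ⟨c, hc⟩ := (Set.ne_univ_iff_exists_notMem _).1 hne
  refine ⟨c, ?_⟩
  rw [isSMulRegular_iff_right_eq_zero_of_smul]
  intro m hm
  by_contra hm0
  have hmem : φ c ∈ ⋃ p ∈ associatedPrimes S M, (p : Set S) := by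
    rw [biUnion_associatedPrimes_eq_zero_divisors]
    exact ⟨m, hm0, hm⟩
  simp only [Set.mem_iUnion] at hmem hc
  obtain ⟨p, hp, hpc⟩ := hmem
  exact hc ⟨_, Finset.mem_image.2 ⟨p, hfin.mem_toFinset.2 hp, rfl⟩, hpc⟩

/-- If the Koszul cohomology of `M` vanishes below degree `T` and `A` is a space of elements of `M`
that meets `(x) M` trivially, then `A` generates at least `T * dim A` dimensions in the next
degree. -/
theorem mul_finrank_le_of_koszulVanish [Infinite L] (T : ℕ) :
    ∀ (M : Type) [AddCommGroup M] [Module S M] [Module L M] [IsScalarTower L S M]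
      [Module.Finite S M], (∀ k < T, KoszulVanish x M k) →
      ∀ A B : Submodule L M, FiniteDimensional L A → FiniteDimensional L B →
      (∀ a ∈ A, a ∈ Ideal.span (Set.range x) • (⊤ : Submodule S M) → a = 0) →
      (∀ i, ∀ a ∈ A, x i • a ∈ B) →
      T * Module.finrank L A ≤ Module.finrank L B := by
  induction T with
  | zero => intros; simp
  | succ T ih =>
    intro M _ _ _ _ _ hM A B hA hB hAx hAB
    obtain ⟨c, hreg⟩ := exists_isSMulRegular_linearForm (L := L) x M
      (fun m hm => eq_zero_of_koszulVanish_zero x (hM 0 (by omega)) hm)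
    set θ := ∑ i, c i • x i with hθ
    have hθx : θ ∈ Ideal.span (Set.range x) := Ideal.sum_mem _ fun i _ => by
      rw [Algebra.smul_def]
      exact Ideal.mul_mem_left _ _ (Ideal.subset_span ⟨i, rfl⟩)
    have hθB : ∀ a ∈ A, θ • a ∈ B := fun a ha => by
      rw [hθ, Finset.sum_smul]
      exact B.sum_mem fun i _ => by
        rw [smul_assoc]
        exact B.smul_mem _ (hAB i a ha)
    have hle : θ • (⊤ : Submodule S M) ≤ Ideal.span (Set.range x) • (⊤ : Submodule S M) := by
      intro m hm
      obtain ⟨m', -, rfl⟩ := (Submodule.mem_smul_pointwise_iff_exists _ _ _).1 hm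
      exact Submodule.smul_mem_smul hθx trivial
    let q : M →ₗ[L] QuotSMulTop θ M := (θ • (⊤ : Submodule S M)).mkQ.restrictScalars L
    have hqx : ∀ (s : S) (m : M), q (s • m) = s • q m := fun s m =>
      map_smul (θ • (⊤ : Submodule S M)).mkQ s m
    have hq0 : ∀ m, q m = 0 ↔ m ∈ θ • (⊤ : Submodule S M) := fun m =>
      Submodule.Quotient.mk_eq_zero _
    have key := ih (QuotSMulTop θ M)
      (fun k hk => (hM k (by omega)).quotSMulTop x hreg (hM (k + 1) (by omega)))
      (A.map q) (B.map q) inferInstance inferInstance ?_ ?_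
    · have h1 : Module.finrank L (A.map q) = Module.finrank L A := by
        rw [← Submodule.range_subtype A, ← LinearMap.range_comp]
        rw [LinearMap.finrank_range_of_inj, Submodule.range_subtype]
        rw [injective_iff_map_eq_zero]
        rintro ⟨a, ha⟩ h0
        exact Subtype.ext (hAx a ha (hle ((hq0 a).1 h0)))
      have h2 : Module.finrank L (B.map q) + Module.finrank L (LinearMap.ker (q ∘ₗ B.subtype)) =
          Module.finrank L B := by
        rw [← LinearMap.finrank_range_add_finrank_ker (q ∘ₗ B.subtype), LinearMap.range_comp,
          Submodule.range_subtype]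
      have h3 : Module.finrank L A ≤ Module.finrank L (LinearMap.ker (q ∘ₗ B.subtype)) := by
        let f : A →ₗ[L] LinearMap.ker (q ∘ₗ B.subtype) :=
          { toFun := fun a => ⟨⟨θ • (a : M), hθB a a.2⟩, (hq0 _).2
              (Submodule.smul_mem_pointwise_smul _ _ _ trivial)⟩
            map_add' := fun a b => by
              apply Subtype.ext
              apply Subtype.ext
              simp
            map_smul' := fun r a => by
              apply Subtype.ext
              apply Subtype.ext
              simp [smul_algebra_smul_comm] }
        refine LinearMap.finrank_le_finrank_of_injective (f := f) ?_
        intro a b hab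
        apply Subtype.ext
        apply hreg
        exact congrArg (fun z : LinearMap.ker (q ∘ₗ B.subtype) => ((z : B) : M)) hab
      rw [h1] at key
      rw [Nat.succ_mul]
      omega
    · rintro _ ⟨a, ha, rfl⟩ hmem
      have hmap : (Ideal.span (Set.range x) • (⊤ : Submodule S M)).map
          (θ • (⊤ : Submodule S M)).mkQ = Ideal.span (Set.range x) • ⊤ := by
        rw [Submodule.map_smul'', Submodule.map_top, Submodule.range_mkQ]
      rw [← hmap] at hmem
      obtain ⟨m, hm, hma⟩ := hmem
      have h1 : a - m ∈ θ • (⊤ : Submodule S M) := by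
        rw [← hq0, map_sub, sub_eq_zero]
        exact hma.symm
      have h2 : a = 0 := hAx a ha (by simpa using Submodule.add_mem _ (hle h1) hm)
      simp [h2]
    · rintro i _ ⟨a, ha, rfl⟩
      rw [← hqx]
      exact ⟨_, hAB i a ha, rfl⟩

end GenericLinearForm

section ScalarExtension

open TensorProduct

attribute [local instance] MvPolynomial.algebraMvPolynomial

variable {K : Type} [Field K] {n : ℕ} (I J : Ideal (MvPolynomial (Fin n) K))
  (L : Type) [Field L] [Algebra K L]

lemma algebraMap_X_eq (i : Fin n) :
    algebraMap (MvPolynomial (Fin n) K) (MvPolynomial (Fin n) L) (X i) = X i :=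
  MvPolynomial.map_X _ _

lemma algebraMap_monomial_one (a : Fin n →₀ ℕ) :
    algebraMap (MvPolynomial (Fin n) K) (MvPolynomial (Fin n) L) (monomial a 1) =
      monomial a 1 := by
  change MvPolynomial.map _ _ = _
  rw [map_monomial, map_one]

/-- The quotient map `I → I/J`. -/
def quotMk : ↥I →ₗ[MvPolynomial (Fin n) K] quotMod I J :=
  Submodule.mkQ (Submodule.comap (Submodule.subtype I) J)

lemma quotMk_surjective : Function.Surjective (quotMk I J) := Submodule.mkQ_surjective _

lemma quotMk_eq_zero (p : ↥I) : quotMk I J p = 0 ↔ (p : MvPolynomial (Fin n) K) ∈ J :=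
  Submodule.Quotient.mk_eq_zero _

instance finite_quotMod : Module.Finite (MvPolynomial (Fin n) K) (quotMod I J) :=
  inferInstanceAs (Module.Finite _ (↥I ⧸ (Submodule.comap (Submodule.subtype I) J)))

/-- The extension of `I/J` to the coefficient field `L`. -/
def extQuot : Type := MvPolynomial (Fin n) L ⊗[MvPolynomial (Fin n) K] quotMod I J

instance : AddCommGroup (extQuot I J L) := by unfold extQuot; infer_instance

instance : Module (MvPolynomial (Fin n) L) (extQuot I J L) := by unfold extQuot; infer_instance

instance : Module L (extQuot I J L) := by unfold extQuot; infer_instance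

instance : IsScalarTower L (MvPolynomial (Fin n) L) (extQuot I J L) :=
  inferInstanceAs (IsScalarTower L (MvPolynomial (Fin n) L)
    (MvPolynomial (Fin n) L ⊗[MvPolynomial (Fin n) K] quotMod I J))

instance : Module.Finite (MvPolynomial (Fin n) L) (extQuot I J L) :=
  inferInstanceAs (Module.Finite (MvPolynomial (Fin n) L)
    (MvPolynomial (Fin n) L ⊗[MvPolynomial (Fin n) K] quotMod I J))

lemma flat_mvPolynomial : Module.Flat (MvPolynomial (Fin n) K) (MvPolynomial (Fin n) L) :=
  Module.Flat.isBaseChange K _ L _ Algebra.IsPushout.out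

lemma koszulVanish_extQuot {T : ℕ} (h : (T : ℕ∞) ≤ mdepth K n (quotMod I J)) :
    ∀ k < T, KoszulVanish (X : Fin n → MvPolynomial (Fin n) L) (extQuot I J L) k := by
  intro k hk
  have h1 : (k : ℕ∞) < mdepth K n (quotMod I J) := lt_of_lt_of_le (by exact_mod_cast hk) h
  obtain ⟨_, ⟨rs, hmem, hreg, rfl⟩, hlt⟩ := lt_sSup_iff.1 h1
  have := flat_mvPolynomial (K := K) (n := n) L
  have hw := hreg.toIsWeaklyRegular.of_flat_of_isBaseChange
    (TensorProduct.isBaseChange (MvPolynomial (Fin n) K) (quotMod I J) (MvPolynomial (Fin n) L))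
  refine KoszulVanish.of_isWeaklyRegular X _ _ ?_ hw k (by simpa using hlt)
  intro r hr
  obtain ⟨s, hs, rfl⟩ := List.mem_map.1 hr
  have h2 := Ideal.mem_map_of_mem (algebraMap (MvPolynomial (Fin n) K) (MvPolynomial (Fin n) L))
    (hmem s hs)
  rw [maxIdeal, Ideal.map_span, ← Set.range_comp] at h2
  have h3 : (algebraMap (MvPolynomial (Fin n) K) (MvPolynomial (Fin n) L)) ∘ X = X := by
    funext i
    exact algebraMap_X_eq L i
  rwa [h3] at h2

/-- The extension of an ideal to the coefficient field `L`. -/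
abbrev extIdeal : Ideal (MvPolynomial (Fin n) L) :=
  I.map (algebraMap (MvPolynomial (Fin n) K) (MvPolynomial (Fin n) L))

variable {I J}

lemma mem_expSet_iff {b : Fin n →₀ ℕ} : b ∈ expSet I ↔ monomial b (1 : K) ∈ I := Iff.rfl

lemma mem_expSet_of_coeff_ne_zero {P : (Fin n →₀ ℕ) → Prop} (hI : GenBy I P)
    {p : MvPolynomial (Fin n) L} (hp : p ∈ extIdeal I L) {b : Fin n →₀ ℕ} (hb : p.coeff b ≠ 0) :
    b ∈ expSet I := by
  obtain ⟨G, -, rfl⟩ := hI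
  have h3 : (algebraMap (MvPolynomial (Fin n) K) (MvPolynomial (Fin n) L)) ''
      ((fun a => monomial a (1 : K)) '' G) = (fun a => monomial a (1 : L)) '' G := by
    rw [Set.image_image]
    simp only [algebraMap_monomial_one]
  rw [extIdeal, Ideal.map_span, h3, mem_ideal_span_monomial_image] at hp
  obtain ⟨g, hg, hgb⟩ := hp b (mem_support_iff.2 hb)
  rw [mem_expSet_iff, mem_ideal_span_monomial_image]
  intro c hc
  rw [Finset.mem_singleton.1 (support_monomial_subset hc)]
  exact ⟨g, hg, hgb⟩

lemma exists_le_of_mem_expSet {P : (Fin n →₀ ℕ) → Prop} (hI : GenBy I P) {b : Fin n →₀ ℕ}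
    (hb : b ∈ expSet I) : ∃ g, P g ∧ g ≤ b := by
  obtain ⟨G, hG, rfl⟩ := hI
  rw [mem_expSet_iff, mem_ideal_span_monomial_image] at hb
  obtain ⟨g, hg, hgb⟩ := hb b (by simp)
  exact ⟨g, hG g hg, hgb⟩

lemma add_single_mem_expSet {b : Fin n →₀ ℕ} (hb : b ∈ expSet I) (i : Fin n) :
    b + Finsupp.single i 1 ∈ expSet I := by
  change monomial _ (1 : K) ∈ I
  have := I.mul_mem_left (X i) hb
  rwa [X, monomial_mul, add_comm, one_mul] at this

variable (I J)

/-- The map `I/J → L[x]/J L[x]`. -/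
def quotToQuot : quotMod I J →ₗ[MvPolynomial (Fin n) K] MvPolynomial (Fin n) L ⧸ extIdeal J L :=
  Submodule.liftQ (Submodule.comap (Submodule.subtype I) J)
    (((extIdeal J L).mkQ.restrictScalars (MvPolynomial (Fin n) K)) ∘ₗ
      (Algebra.linearMap (MvPolynomial (Fin n) K) (MvPolynomial (Fin n) L)) ∘ₗ
        (Submodule.subtype I)) (by
      intro p hp
      exact (Submodule.Quotient.mk_eq_zero _).2 (Ideal.mem_map_of_mem _ hp))

/-- The map `L[x] ⊗ I/J → L[x]/J L[x]`. -/
def extToQuot : extQuot I J L →ₗ[MvPolynomial (Fin n) L] MvPolynomial (Fin n) L ⧸ extIdeal J L :=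
  LinearMap.liftBaseChange (MvPolynomial (Fin n) L) (quotToQuot I J L)

/-- The element `s ⊗ p` of the extension of `I/J`. -/
def extTmul (s : MvPolynomial (Fin n) L) (p : ↥I) : extQuot I J L := s ⊗ₜ quotMk I J p

lemma smul_extTmul (r s : MvPolynomial (Fin n) L) (p : ↥I) :
    r • extTmul I J L s p = extTmul I J L (r * s) p := rfl

lemma extTmul_algebraMap_mul (r : MvPolynomial (Fin n) K) (s : MvPolynomial (Fin n) L) (p : ↥I) :
    extTmul I J L (algebraMap _ _ r * s) p = extTmul I J L s (r • p) := by
  rw [extTmul, extTmul, ← Algebra.smul_def, map_smul, smul_tmul]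

lemma extTmul_eq_zero (s : MvPolynomial (Fin n) L) {p : ↥I}
    (hp : (p : MvPolynomial (Fin n) K) ∈ J) : extTmul I J L s p = 0 := by
  rw [extTmul, (quotMk_eq_zero I J p).2 hp]
  exact tmul_zero _ s

lemma extQuot_induction {motive : extQuot I J L → Prop} (zero : motive 0)
    (tmul : ∀ s p, motive (extTmul I J L s p)) (add : ∀ y z, motive y → motive z → motive (y + z))
    (z : extQuot I J L) : motive z :=
  TensorProduct.induction_on z zero (fun s y => by
    obtain ⟨p, rfl⟩ := quotMk_surjective I J y
    exact tmul s p) add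

lemma extToQuot_extTmul (s : MvPolynomial (Fin n) L) (p : ↥I) :
    extToQuot I J L (extTmul I J L s p) =
      (extIdeal J L).mkQ (s * algebraMap _ _ (p : MvPolynomial (Fin n) K)) :=
  LinearMap.liftBaseChange_tmul (MvPolynomial (Fin n) L) (quotToQuot I J L) s (quotMk I J p)

lemma exists_extToQuot_eq (z : extQuot I J L) :
    ∃ p ∈ extIdeal I L, extToQuot I J L z = (extIdeal J L).mkQ p := by
  induction z using extQuot_induction with
  | zero => exact ⟨0, Submodule.zero_mem _, by rw [map_zero, map_zero]⟩
  | tmul s p =>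
    exact ⟨_, Ideal.mul_mem_left _ s (Ideal.mem_map_of_mem _ p.2), extToQuot_extTmul I J L s p⟩
  | add y z hy hz =>
    obtain ⟨p, hp, hyp⟩ := hy
    obtain ⟨q, hq, hzq⟩ := hz
    exact ⟨p + q, Submodule.add_mem _ hp hq, by rw [map_add, map_add, hyp, hzq]⟩

open Classical in
/-- The coefficient of `x^b` on the extension of `I/J`, for `x^b ∉ J` (and `0` for `x^b ∈ J`). -/
def extCoeff {P : (Fin n →₀ ℕ) → Prop} (hJ : GenBy J P) (b : Fin n →₀ ℕ) :
    extQuot I J L →ₗ[L] L :=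
  if hb : b ∈ expSet J then 0 else
    (Submodule.liftQ ((extIdeal J L).restrictScalars L) (MvPolynomial.lcoeff L b) (by
      intro p hp
      by_contra hne
      exact hb (mem_expSet_of_coeff_ne_zero L hJ hp hne))) ∘ₗ
    (Submodule.Quotient.restrictScalarsEquiv L (extIdeal J L)).symm.toLinearMap ∘ₗ
    ((extToQuot I J L).restrictScalars L)

open Classical in
/-- The class of `x^a` in the extension of `I/J`, for `x^a ∈ I` (and `0` for `x^a ∉ I`). -/
def extMono (a : Fin n →₀ ℕ) : extQuot I J L :=
  if ha : a ∈ expSet I then extTmul I J L 1 ⟨monomial a 1, mem_expSet_iff.1 ha⟩ else 0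

variable {I J}

lemma extCoeff_eq {P : (Fin n →₀ ℕ) → Prop} (hJ : GenBy J P) {b : Fin n →₀ ℕ}
    (hb : b ∉ expSet J) {z : extQuot I J L} {p : MvPolynomial (Fin n) L}
    (hp : extToQuot I J L z = (extIdeal J L).mkQ p) : extCoeff I J L hJ b z = p.coeff b := by
  rw [extCoeff, dif_neg hb]
  simp only [LinearMap.comp_apply, LinearMap.restrictScalars_apply, hp]
  rfl

lemma extCoeff_of_mem {P : (Fin n →₀ ℕ) → Prop} (hJ : GenBy J P) {b : Fin n →₀ ℕ}
    (hb : b ∈ expSet J) (z : extQuot I J L) : extCoeff I J L hJ b z = 0 := by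
  rw [extCoeff, dif_pos hb, LinearMap.zero_apply]

lemma extCoeff_of_notMem {P Q : (Fin n →₀ ℕ) → Prop} (hI : GenBy I P) (hJ : GenBy J Q)
    {b : Fin n →₀ ℕ} (hb : b ∉ expSet I) (z : extQuot I J L) : extCoeff I J L hJ b z = 0 := by
  by_cases hbJ : b ∈ expSet J
  · exact extCoeff_of_mem L hJ hbJ z
  obtain ⟨p, hp, hzp⟩ := exists_extToQuot_eq I J L z
  rw [extCoeff_eq L hJ hbJ hzp]
  by_contra hne
  exact hb (mem_expSet_of_coeff_ne_zero L hI hp hne)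

lemma extCoeff_add_single {P : (Fin n →₀ ℕ) → Prop} (hJ : GenBy J P)
    {b : Fin n →₀ ℕ} {i : Fin n} (hb : b + Finsupp.single i 1 ∉ expSet J) (z : extQuot I J L) :
    extCoeff I J L hJ (b + Finsupp.single i 1) ((X i : MvPolynomial (Fin n) L) • z) =
      extCoeff I J L hJ b z := by
  obtain ⟨p, hp, hzp⟩ := exists_extToQuot_eq I J L z
  rw [extCoeff_eq L hJ (fun h => hb (add_single_mem_expSet h i)) hzp,
    extCoeff_eq L hJ (p := X i * p) hb, add_comm, coeff_X_mul]
  rw [map_smul, hzp, ← map_smul, smul_eq_mul]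

lemma extCoeff_X_smul_of_eq_zero {P : (Fin n →₀ ℕ) → Prop} (hJ : GenBy J P)
    {b : Fin n →₀ ℕ} {i : Fin n} (hb : b ∉ expSet J) (hi : b i = 0) (z : extQuot I J L) :
    extCoeff I J L hJ b ((X i : MvPolynomial (Fin n) L) • z) = 0 := by
  obtain ⟨p, hp, hzp⟩ := exists_extToQuot_eq I J L z
  rw [extCoeff_eq L hJ (p := X i * p) hb, coeff_X_mul', if_neg (by simp [hi])]
  rw [map_smul, hzp, ← map_smul, smul_eq_mul]

lemma extMono_of_notMem {a : Fin n →₀ ℕ} (ha : a ∉ expSet I) : extMono I J L a = 0 := by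
  rw [extMono, dif_neg ha]

lemma extMono_of_mem {a : Fin n →₀ ℕ} (ha : a ∈ expSet J) : extMono I J L a = 0 := by
  by_cases haI : a ∈ expSet I
  · rw [extMono, dif_pos haI, extTmul_eq_zero I J L 1 (mem_expSet_iff.1 ha)]
  · exact extMono_of_notMem L haI

lemma X_smul_extMono {a : Fin n →₀ ℕ} (ha : a ∈ expSet I) (i : Fin n) :
    (X i : MvPolynomial (Fin n) L) • extMono I J L a =
      extMono I J L (a + Finsupp.single i 1) := by
  rw [extMono, extMono, dif_pos ha, dif_pos (add_single_mem_expSet ha i)]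
  rw [smul_extTmul, ← algebraMap_X_eq (K := K), extTmul_algebraMap_mul]
  congr 1
  apply Subtype.ext
  change (X i : MvPolynomial (Fin n) K) * monomial a 1 = _
  rw [X, monomial_mul, add_comm, one_mul]

lemma extCoeff_extMono {P : (Fin n →₀ ℕ) → Prop} (hJ : GenBy J P)
    {a b : Fin n →₀ ℕ} (ha : a ∈ expSet I) (hb : b ∉ expSet J) :
    extCoeff I J L hJ b (extMono I J L a) = if a = b then 1 else 0 := by
  rw [extMono, dif_pos ha, extCoeff_eq L hJ hb (extToQuot_extTmul I J L _ _)]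
  rw [algebraMap_monomial_one, one_mul, coeff_monomial]

end ScalarExtension

section SquarefreeCount

attribute [local instance] MvPolynomial.algebraMvPolynomial

lemma edeg_mono {n : ℕ} {a b : Fin n →₀ ℕ} (h : a ≤ b) : edeg a ≤ edeg b :=
  Finset.sum_le_sum fun i _ => h i

/-- The exponent vector of the squarefree monomial `∏_{i ∈ F} x_i`. -/
def sqExp {n : ℕ} (F : Finset (Fin n)) : Fin n →₀ ℕ :=
  Finsupp.equivFunOnFinite.symm fun i => if i ∈ F then 1 else 0

variable {n : ℕ}

lemma sqExp_apply (F : Finset (Fin n)) (i : Fin n) : sqExp F i = if i ∈ F then 1 else 0 := rfl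

lemma sqExp_injective : Function.Injective (sqExp (n := n)) := by
  intro F G h
  ext i
  have := DFunLike.congr_fun h i
  simp only [sqExp_apply] at this
  by_cases h1 : i ∈ F <;> by_cases h2 : i ∈ G <;> simp_all

lemma edeg_sqExp (F : Finset (Fin n)) : edeg (sqExp F) = F.card := by
  simp [edeg, sqExp_apply]

lemma isSqfree_sqExp (F : Finset (Fin n)) : IsSqfree (sqExp F) := by
  intro i
  rw [sqExp_apply]
  split_ifs <;> omega

lemma IsSqfree.sqExp_support {a : Fin n →₀ ℕ} (ha : IsSqfree a) : sqExp a.support = a := by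
  ext i
  have := ha i
  have h := Finsupp.mem_support_iff (f := a) (a := i)
  rw [sqExp_apply]
  split_ifs with h1
  · have := h.1 h1
    omega
  · exact (not_not.1 (mt h.2 h1)).symm

lemma sqExp_erase_add {F : Finset (Fin n)} {i : Fin n} (hi : i ∈ F) :
    sqExp (F.erase i) + Finsupp.single i 1 = sqExp F := by
  ext j
  rw [Finsupp.add_apply, sqExp_apply, sqExp_apply, Finsupp.single_apply]
  by_cases h : i = j
  · subst h; simp [hi]
  · simp [h, Ne.symm h]

lemma sqExp_insert {F : Finset (Fin n)} {i : Fin n} (hi : i ∉ F) :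
    sqExp F + Finsupp.single i 1 = sqExp (insert i F) := by
  rw [← sqExp_erase_add (Finset.mem_insert_self i F), Finset.erase_insert hi]

variable {K : Type} [Field K] {I J : Ideal (MvPolynomial (Fin n) K)}

variable (I J) in
open Classical in
/-- The supports of the squarefree monomials of degree `k` in `I ∖ J`. -/
def sqFaces (k : ℕ) : Finset (Finset (Fin n)) :=
  Finset.univ.filter fun F => F.card = k ∧ sqExp F ∈ expSet I ∧ sqExp F ∉ expSet J

lemma mem_sqFaces {k : ℕ} {F : Finset (Fin n)} :
    F ∈ sqFaces I J k ↔ F.card = k ∧ sqExp F ∈ expSet I ∧ sqExp F ∉ expSet J := by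
  simp [sqFaces]

lemma rho_eq_card (k : ℕ) : rho I J k = (sqFaces I J k).card := by
  have : {a : Fin n →₀ ℕ | IsSqfree a ∧ edeg a = k ∧ a ∈ expSet I ∧ a ∉ expSet J} =
      sqExp '' (sqFaces I J k : Set (Finset (Fin n))) := by
    ext a
    simp only [Set.mem_ofPred_eq, Set.mem_image, Finset.mem_coe, mem_sqFaces]
    constructor
    · rintro ⟨h1, h2, h3, h4⟩
      refine ⟨a.support, ?_, h1.sqExp_support⟩
      rw [h1.sqExp_support]
      refine ⟨?_, h3, h4⟩
      rw [← edeg_sqExp, h1.sqExp_support, h2]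
    · rintro ⟨F, ⟨h2, h3, h4⟩, rfl⟩
      exact ⟨isSqfree_sqExp F, by rw [edeg_sqExp, h2], h3, h4⟩
  rw [rho, this, Set.ncard_image_of_injective _ sqExp_injective, Set.ncard_coe_finset]

lemma rhoI_eq_rho {Q : (Fin n →₀ ℕ) → Prop} (hJ : GenBy J Q) {d : ℕ}
    (hQ : ∀ a, Q a → d < edeg a) : rhoI I d = rho I J d := by
  unfold rhoI rho
  congr 1
  ext a
  simp only [Set.mem_ofPred_eq]
  constructor
  · rintro ⟨h1, h2, h3⟩
    refine ⟨h1, h2, h3, fun h4 => ?_⟩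
    obtain ⟨g, hg, hga⟩ := exists_le_of_mem_expSet hJ h4
    have := hQ g hg
    have := edeg_mono hga
    omega
  · rintro ⟨h1, h2, h3, -⟩
    exact ⟨h1, h2, h3⟩

variable (L : Type) [Field L]

variable (I J) in
/-- Extension by zero of functions on the squarefree monomials of degree `k` in `I ∖ J`. -/
def extendSqFaces (k : ℕ) : (sqFaces I J k → L) →ₗ[L] (Finset (Fin n) → L) :=
  Function.ExtendByZero.linearMap L Subtype.val

lemma extendSqFaces_coe {k : ℕ} (f : sqFaces I J k → L) (F : sqFaces I J k) :
    extendSqFaces I J L k f F = f F :=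
  Subtype.val_injective.extend_apply f 0 F

lemma extendSqFaces_of_notMem {k : ℕ} (f : sqFaces I J k → L) {F : Finset (Fin n)}
    (hF : F ∉ sqFaces I J k) : extendSqFaces I J L k f F = 0 :=
  Function.extend_apply' f (0 : Finset (Fin n) → L) F fun ⟨G, hG⟩ => hF (hG ▸ G.2)

lemma extendSqFaces_restrict {k : ℕ} {γ : Finset (Fin n) → L}
    (hγ : ∀ F, F ∉ sqFaces I J k → γ F = 0) :
    extendSqFaces I J L k (fun F : sqFaces I J k => γ F) = γ := by
  funext F
  by_cases hF : F ∈ sqFaces I J k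
  · exact extendSqFaces_coe L (fun F : sqFaces I J k => γ F) ⟨F, hF⟩
  · rw [hγ F hF, extendSqFaces_of_notMem L _ hF]

variable (I J) in
/-- The squarefree strand of the Koszul differential, in the monomial bases. -/
def sqKoszul (k : ℕ) : (sqFaces I J k → L) →ₗ[L] (sqFaces I J (k + 1) → L) :=
  LinearMap.funLeft L L Subtype.val ∘ₗ koszulD (1 : Fin n → L) L ∘ₗ extendSqFaces I J L k

lemma sqKoszul_apply {k : ℕ} (f : sqFaces I J k → L) (F : sqFaces I J (k + 1)) :
    sqKoszul I J L k f F = koszulD (1 : Fin n → L) L (extendSqFaces I J L k f) F := rfl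

variable [Algebra K L] {P Q : (Fin n →₀ ℕ) → Prop}

lemma extCoeff_eq_zero_of_mem_smul_top (hI : GenBy I P) (hJ : GenBy J Q) {d : ℕ}
    (hP : ∀ a, P a → d ≤ edeg a) {G : Finset (Fin n)} (hG : G.card = d) {z : extQuot I J L}
    (hz : z ∈ Ideal.span (Set.range (X : Fin n → MvPolynomial (Fin n) L)) •
      (⊤ : Submodule (MvPolynomial (Fin n) L) (extQuot I J L))) :
    extCoeff I J L hJ (sqExp G) z = 0 := by
  by_cases hGJ : sqExp G ∈ expSet J
  · exact extCoeff_of_mem L hJ hGJ z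
  have hX : ∀ (i : Fin n) (m : extQuot I J L),
      extCoeff I J L hJ (sqExp G) ((X i : MvPolynomial (Fin n) L) • m) = 0 := by
    intro i m
    by_cases hi : i ∈ G
    · rw [← sqExp_erase_add hi] at hGJ ⊢
      rw [extCoeff_add_single L hJ hGJ]
      refine extCoeff_of_notMem L hI hJ (fun h => ?_) m
      obtain ⟨g, hg, hga⟩ := exists_le_of_mem_expSet hI h
      have h1 := hP g hg
      have h2 := edeg_mono hga
      rw [edeg_sqExp] at h2
      have h3 := Finset.card_erase_add_one hi
      omega
    · exact extCoeff_X_smul_of_eq_zero L hJ hGJ (by simp [sqExp_apply, hi]) m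
  induction hz using Submodule.smul_induction_on' with
  | smul r hr m hm =>
    clear hm
    induction hr using Submodule.span_induction generalizing m with
    | mem y hy => obtain ⟨i, rfl⟩ := hy; exact hX i m
    | zero => rw [zero_smul, map_zero]
    | add x y _ _ hx hy => rw [add_smul, map_add, hx, hy, add_zero]
    | smul a x _ hx => rw [smul_eq_mul, mul_comm, mul_smul, hx]
  | add x _ y _ hx hy => rw [map_add, hx, hy, add_zero]

lemma extCoeff_sum_extMono (hJ : GenBy J Q) {k : ℕ} (c : sqFaces I J k → L)
    (G : sqFaces I J k) :
    extCoeff I J L hJ (sqExp G) (∑ F, c F • extMono I J L (sqExp F)) = c G := by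
  have h : ∀ F : sqFaces I J k, extCoeff I J L hJ (sqExp G) (extMono I J L (sqExp F)) =
      if F = G then 1 else 0 := by
    intro F
    rw [extCoeff_extMono L hJ (mem_sqFaces.1 F.2).2.1 (mem_sqFaces.1 G.2).2.2]
    simp only [sqExp_injective.eq_iff, Subtype.ext_iff]
  simp [map_sum, h]

lemma linearIndependent_extMono (hJ : GenBy J Q) (k : ℕ) :
    LinearIndependent L fun F : sqFaces I J k => extMono I J L (sqExp F) := by
  rw [Fintype.linearIndependent_iff]
  intro c hc G
  rw [← extCoeff_sum_extMono L hJ c G, hc, map_zero]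

theorem two_mul_rho_le [Infinite L] (hI : GenBy I P) (hJ : GenBy J Q) {d : ℕ}
    (hP : ∀ a, P a → d ≤ edeg a)
    (h : ∀ k < d + 2, KoszulVanish (X : Fin n → MvPolynomial (Fin n) L) (extQuot I J L) k) :
    2 * rho I J d ≤ rho I J (d + 1) := by
  classical
  let v : sqFaces I J d → extQuot I J L := fun F => extMono I J L (sqExp F)
  let B : Finset (extQuot I J L) :=
    (sqFaces I J (d + 1)).image (fun F => extMono I J L (sqExp F)) ∪
      (sqFaces I J d).biUnion fun G =>
        G.image fun i => extMono I J L (sqExp G + Finsupp.single i 1)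
  have hBcard : B.card ≤ (sqFaces I J (d + 1)).card + (sqFaces I J d).card * d := by
    refine (Finset.card_union_le _ _).trans (add_le_add Finset.card_image_le ?_)
    refine Finset.card_biUnion_le_card_mul _ _ _ fun G hG => ?_
    exact Finset.card_image_le.trans (mem_sqFaces.1 hG).1.le
  have key := mul_finrank_le_of_koszulVanish (L := L) (X : Fin n → MvPolynomial (Fin n) L) (d + 2)
    (extQuot I J L) h (Submodule.span L (Set.range v)) (Submodule.span L (B : Set (extQuot I J L)))
    (FiniteDimensional.span_of_finite L (Set.finite_range v))
    (FiniteDimensional.span_of_finite L B.finite_toSet) ?_ ?_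
  · have h1 : Module.finrank L (Submodule.span L (Set.range v)) = (sqFaces I J d).card := by
      rw [finrank_span_eq_card (linearIndependent_extMono L hJ d), Fintype.card_coe]
    have h2 := finrank_span_finset_le_card (R := L) B
    rw [rho_eq_card, rho_eq_card]
    rw [h1] at key
    have h3 := (key.trans h2).trans hBcard
    nlinarith
  · intro a ha hax
    obtain ⟨c, rfl⟩ := (Submodule.mem_span_range_iff_exists_fun L).1 ha
    refine Finset.sum_eq_zero fun G _ => ?_
    rw [← extCoeff_sum_extMono L hJ c G,
      extCoeff_eq_zero_of_mem_smul_top L hI hJ hP (mem_sqFaces.1 G.2).1 hax, zero_smul]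
  · intro i a ha
    induction ha using Submodule.span_induction with
    | mem y hy =>
      obtain ⟨⟨G, hG⟩, rfl⟩ := hy
      obtain ⟨hGd, hGI, hGJ⟩ := mem_sqFaces.1 hG
      change (X i : MvPolynomial (Fin n) L) • extMono I J L (sqExp G) ∈ _
      rw [X_smul_extMono L hGI]
      by_cases hi : i ∈ G
      · refine Submodule.subset_span (Finset.mem_coe.2 (Finset.mem_union_right _ ?_))
        exact Finset.mem_biUnion.2 ⟨G, hG, Finset.mem_image_of_mem _ hi⟩
      · have hI' := add_single_mem_expSet hGI i
        rw [sqExp_insert hi] at hI' ⊢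
        by_cases hJ' : sqExp (insert i G) ∈ expSet J
        · rw [extMono_of_mem L hJ']
          exact Submodule.zero_mem _
        · refine Submodule.subset_span (Finset.mem_coe.2 (Finset.mem_union_left _ ?_))
          refine Finset.mem_image_of_mem (fun F => extMono I J L (sqExp F))
            (mem_sqFaces.2 ⟨?_, hI', hJ'⟩)
          rw [Finset.card_insert_of_notMem hi, hGd]
    | zero => rw [smul_zero]; exact Submodule.zero_mem _
    | add x y _ _ hx hy => rw [smul_add]; exact Submodule.add_mem _ hx hy
    | smul c x _ hx => rw [smul_comm]; exact Submodule.smul_mem _ c hx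

lemma koszulD_smul_extMono {k : ℕ} (f : sqFaces I J k → L) (H : Finset (Fin n)) :
    koszulD (X : Fin n → MvPolynomial (Fin n) L) (extQuot I J L)
      (fun F => extendSqFaces I J L k f F • extMono I J L (sqExp F)) H =
    koszulD (1 : Fin n → L) L (extendSqFaces I J L k f) H • extMono I J L (sqExp H) := by
  rw [koszulD_apply, koszulD_apply, Finset.sum_smul]
  refine Finset.sum_congr rfl fun i hi => ?_
  rw [Pi.one_apply, one_smul, smul_assoc]
  congr 1
  by_cases hF : H.erase i ∈ sqFaces I J k
  · rw [smul_comm, X_smul_extMono L (mem_sqFaces.1 hF).2.1, sqExp_erase_add hi]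
  · rw [extendSqFaces_of_notMem L f hF, zero_smul, zero_smul, smul_zero]

lemma ker_sqKoszul_le_range (hI : GenBy I P) (hJ : GenBy J Q) {k : ℕ}
    (h : KoszulVanish (X : Fin n → MvPolynomial (Fin n) L) (extQuot I J L) (k + 1)) :
    LinearMap.ker (sqKoszul I J L (k + 1)) ≤ LinearMap.range (sqKoszul I J L k) := by
  intro f hf
  have hf0 : ∀ F : Finset (Fin n), F.card ≠ k + 1 → extendSqFaces I J L (k + 1) f F = 0 :=
    fun F hF => extendSqFaces_of_notMem L f fun h => hF (mem_sqFaces.1 h).1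
  obtain ⟨g, hg, hgf⟩ := h
    (fun F => extendSqFaces I J L (k + 1) f F • extMono I J L (sqExp F))
    (fun F hF => by rw [hf0 F hF, zero_smul]) (by
      funext H
      rw [koszulD_smul_extMono, Pi.zero_apply]
      by_cases hH : H.card = k + 1 + 1
      · by_cases hHI : sqExp H ∈ expSet I
        · by_cases hHJ : sqExp H ∈ expSet J
          · rw [extMono_of_mem L hHJ, smul_zero]
          · rw [← sqKoszul_apply L f ⟨H, mem_sqFaces.2 ⟨hH, hHI, hHJ⟩⟩, LinearMap.mem_ker.1 hf,
              Pi.zero_apply, zero_smul]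
        · rw [extMono_of_notMem L hHI, smul_zero]
      · rw [koszulD_support _ (fun F hF => hf0 F (by omega)) H hH, zero_smul])
  let γ : Finset (Fin n) → L := fun G => extCoeff I J L hJ (sqExp G) (g G)
  have hγ : ∀ G, G ∉ sqFaces I J k → γ G = 0 := by
    intro G hG
    by_cases hk : G.card = k
    · by_cases hGJ : sqExp G ∈ expSet J
      · exact extCoeff_of_mem L hJ hGJ _
      · exact extCoeff_of_notMem L hI hJ (fun hGI => hG (mem_sqFaces.2 ⟨hk, hGI, hGJ⟩)) _
    · change extCoeff I J L hJ _ (g G) = 0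
      rw [hg G (by omega), map_zero]
  refine ⟨fun G => γ G, ?_⟩
  funext F
  obtain ⟨-, hFI, hFJ⟩ := mem_sqFaces.1 F.2
  rw [sqKoszul_apply, extendSqFaces_restrict L hγ]
  have h1 := congrArg (extCoeff I J L hJ (sqExp F)) (congrFun hgf F)
  rw [extendSqFaces_coe, map_smul, extCoeff_extMono L hJ hFI hFJ, if_pos rfl, smul_eq_mul,
    mul_one] at h1
  rw [← h1, koszulD_apply, koszulD_apply, map_sum]
  refine Finset.sum_congr rfl fun i hi => ?_
  rw [map_zsmul, Pi.one_apply, one_smul]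
  congr 1
  have h2 := sqExp_erase_add hi
  rw [← h2] at hFJ ⊢
  rw [extCoeff_add_single L hJ hFJ]

theorem rho_le_of_koszulVanish (hI : GenBy I P) (hJ : GenBy J Q) {k : ℕ}
    (h : KoszulVanish (X : Fin n → MvPolynomial (Fin n) L) (extQuot I J L) (k + 1)) :
    rho I J (k + 1) ≤ rho I J k + rho I J (k + 2) := by
  have h1 := LinearMap.finrank_range_add_finrank_ker (sqKoszul I J L (k + 1))
  have h2 := Submodule.finrank_mono (ker_sqKoszul_le_range L hI hJ h)
  have h3 := LinearMap.finrank_range_le (sqKoszul I J L k)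
  have h4 := Submodule.finrank_le (LinearMap.range (sqKoszul I J L (k + 1)))
  simp only [Module.finrank_fintype_fun_eq_card, Fintype.card_coe] at h1 h3 h4
  simp only [rho_eq_card, add_assoc, Nat.reduceAdd] at h4 ⊢
  omega

end SquarefreeCount

/-- Corollary to Theorem `popescu-gen`. Let `J ⊊ I` be squarefree
monomial ideals of `S`, generated by monomials of degrees `≥ d` and `≥ d+1` respectively.
If `depth_S(I/J) ≥ d+2`, then `2ρ_d(I) ≤ ρ_{d+1}(I∖J) ≤ ρ_d(I) + ρ_{d+2}(I∖J)`; in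
particular, if `ρ_{d+2}(I∖J) = 0` then `ρ_d(I) = ρ_{d+1}(I∖J) = 0`. -/
theorem rho_ineq_of_depth_ge {K : Type} [Field K] {n d : ℕ}
    (I J : Ideal (MvPolynomial (Fin n) K)) (hJI : J < I)
    (hsqI : GenBy I (fun a => IsSqfree a ∧ d ≤ edeg a))
    (hsqJ : GenBy J (fun a => IsSqfree a ∧ d + 1 ≤ edeg a))
    (hdepth : ((d + 2 : ℕ) : ℕ∞) ≤ mdepth K n (quotMod I J)) :
    2 * rhoI I d ≤ rho I J (d + 1) ∧ rho I J (d + 1) ≤ rhoI I d + rho I J (d + 2) ∧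
      (rho I J (d + 2) = 0 → rhoI I d = 0 ∧ rho I J (d + 1) = 0) := by
  have hK := koszulVanish_extQuot I J (AlgebraicClosure K) hdepth
  have hinf : Infinite (AlgebraicClosure K) := IsAlgClosed.instInfinite
  have h1 := two_mul_rho_le (AlgebraicClosure K) hsqI hsqJ (fun a ha => ha.2) hK
  have h2 := rho_le_of_koszulVanish (AlgebraicClosure K) hsqI hsqJ (hK (d + 1) (by omega))
  rw [rhoI_eq_rho hsqJ fun a ha => ha.2]
  omega
end
end

section
/- The Stanley conjecture holds for squarefree stable ideals: if I ⊂ S = K[x_1,…,x_n] is a nonzero squarefree stable monomial ideal, then sdepth_n(I) ≥ depth(I). -/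
noncomputable section

open MvPolynomial

open MvPolynomial

section RegularSequences

open CategoryTheory Abelian RingTheory.Sequence Pointwise

/-- Nakayama's lemma at a maximal ideal `m` of a ring that need not be local. -/
lemma exists_notMem_smul_eq_zero {R E : Type*} [CommRing R] [AddCommGroup E] [Module R E]
    [Module.Finite R E] (m : Ideal R) [hm : m.IsMaximal] {s : R} (hs : s ∉ m)
    (h : ∀ e : E, s • e ∈ m • (⊤ : Submodule R E)) :
    ∃ r ∉ m, ∀ e : E, r • e = 0 := by
  obtain ⟨t, ht⟩ := hm.exists_inv hs
  obtain ⟨i, hi, hti⟩ := ht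
  have hle : (⊤ : Submodule R E) ≤ m • ⊤ := fun e _ => by
    have he : e = t • s • e + i • e := by rw [smul_smul, ← add_smul, hti, one_smul]
    rw [he]
    exact add_mem (Submodule.smul_mem _ _ (h e)) (Submodule.smul_mem_smul hi trivial)
  obtain ⟨r, hr, hr0⟩ := Submodule.exists_sub_one_mem_and_smul_eq_zero_of_fg_of_le_smul m ⊤
    Module.Finite.fg_top hle
  refine ⟨r, fun hrm => hm.ne_top ((Ideal.eq_top_iff_one m).2 ?_), fun e => hr0 e trivial⟩
  simpa using sub_mem hrm hr

/-- Grade-dimension inequality: if `ys` is weakly regular on `N` and `N / (ys) N` is supported at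
the maximal ideal `m`, then `Ext N M i` vanishes locally at `m` for `i + ys.length` smaller than
the length of an `M`-regular sequence in `m`. -/
lemma exists_smul_ext_eq_zero {R : Type} [CommRing R] [IsNoetherianRing R] (m : Ideal R)
    [hm : m.IsMaximal] (M : ModuleCat.{0} R) [Module.Finite R M]
    (hlt : m • (⊤ : Submodule R M) < ⊤) (rs : List R) (hrs : ∀ r ∈ rs, r ∈ m)
    (reg : IsRegular M rs) (ys : List R) (hys : ∀ y ∈ ys, y ∈ m)
    (N : ModuleCat.{0} R) [Module.Finite R N] (hN : IsWeaklyRegular N ys)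
    (hsupp : Module.support R (N ⧸ (Ideal.ofList ys • ⊤ : Submodule R N)) ⊆
      PrimeSpectrum.zeroLocus m) (i : ℕ) (hi : i + ys.length < rs.length) :
    ∃ s ∉ m, ∀ e : Ext N M i, s • e = 0 := by
  induction ys generalizing N i with
  | nil =>
    have : Subsingleton (Ext N M i) := by
      refine ModuleCat.subsingleton_ext_of_exists_isRegular m N ?_ M hlt rs hrs reg i (by simpa using hi)
      rwa [(Submodule.quotEquivOfEqBot (Ideal.ofList [] • ⊤ : Submodule R N)
        (by simp)).support_eq] at hsupp
    exact ⟨1, m.one_notMem, fun e => Subsingleton.elim _ _⟩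
  | cons y ys ih =>
    rw [isWeaklyRegular_cons_iff] at hN
    rw [(Submodule.quotOfListConsSMulTopEquivQuotSMulTopInner N y ys).support_eq] at hsupp
    obtain ⟨s, hs, hs0⟩ := ih (fun z hz => hys z (List.mem_cons_of_mem _ hz))
      (ModuleCat.of R (QuotSMulTop y N)) hN.2 hsupp (i + 1)
      (by rw [List.length_cons] at hi; omega)
    have hy : y ∈ m := hys y List.mem_cons_self
    refine exists_notMem_smul_eq_zero m hs fun e => ?_
    obtain ⟨e', he'⟩ : ∃ e' : Ext N M i,
        (Ext.mk₀ (y • 𝟙 N)).comp e' (zero_add i) = s • e :=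
      Ext.contravariant_sequence_exact₁ hN.1.smulShortComplex_shortExact M (s • e) (add_comm 1 i)
        ((Ext.comp_smul hN.1.smulShortComplex_shortExact.extClass e (add_comm 1 i) s).trans (hs0 _))
    rw [← he', Ext.mk₀_smul, Ext.smul_comp, Ext.mk₀_id_comp]
    exact Submodule.smul_mem_smul hy trivial

lemma isMaximal_maxIdeal (K : Type) [Field K] (n : ℕ) : (maxIdeal K n).IsMaximal := by
  have h : maxIdeal K n = RingHom.ker (constantCoeff (R := K) (σ := Fin n)) := by
    ext p
    rw [maxIdeal, ← Set.image_univ, mem_ideal_span_X_image, RingHom.mem_ker,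
      constantCoeff_eq]
    refine ⟨fun h => by_contra fun h0 => ?_, fun h a ha => ?_⟩
    · simpa using h 0 (mem_support_iff.2 h0)
    · by_contra! h1
      have : a = 0 := Finsupp.ext fun i => h1 i trivial
      exact mem_support_iff.1 ha (this ▸ h)
  rw [h]
  exact RingHom.ker_isMaximal_of_surjective _ fun a => ⟨C a, constantCoeff_C _ a⟩

lemma coeff_zero_ne_zero_of_notMem_maxIdeal {K : Type} [Field K] {n : ℕ}
    {s : MvPolynomial (Fin n) K} (hs : s ∉ maxIdeal K n) : coeff 0 s ≠ 0 := by
  contrapose! hs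
  rw [maxIdeal, ← Set.image_univ, mem_ideal_span_X_image]
  intro a ha
  by_contra! h1
  have : a = 0 := Finsupp.ext fun i => h1 i trivial
  exact mem_support_iff.1 ha (this ▸ hs)

/-- Distinct variables form a weakly regular sequence. -/
lemma isWeaklyRegular_map_X {K σ : Type} [Field K] (l : List σ) (hl : l.Nodup) :
    IsWeaklyRegular (MvPolynomial σ K) (l.map (X (R := K))) := by
  rw [isWeaklyRegular_iff]
  intro i hi
  have hi' : i < l.length := by simpa using hi
  have hspan : (Ideal.ofList ((l.map (X (R := K))).take i) • ⊤ : Ideal (MvPolynomial σ K)) =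
      Ideal.span (X '' {j | j ∈ l.take i}) := by
    rw [smul_eq_mul, Ideal.mul_top, Ideal.ofList]
    congr 1
    ext p
    simp [← List.map_take]
  have hnot : l[i] ∉ l.take i := by
    intro h
    obtain ⟨j, hj, hji⟩ := List.mem_take_iff_getElem.1 h
    have := (List.Nodup.getElem_inj_iff hl).1 hji
    omega
  rw [isSMulRegular_quotient_iff_mem_of_smul_mem]
  intro p hp
  rw [hspan, mem_ideal_span_X_image] at hp ⊢
  intro a ha
  obtain ⟨j, hj, hja⟩ := hp (a + Finsupp.single l[i] 1) (by
    rw [List.getElem_map, smul_eq_mul, mul_comm, mem_support_iff, coeff_mul_X]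
    exact mem_support_iff.1 ha)
  refine ⟨j, hj, ?_⟩
  have : l[i] ≠ j := fun h => hnot (h ▸ hj)
  simpa [Finsupp.single_apply, this] using hja

lemma maxIdeal_smul_top_lt {K : Type} [Field K] {n : ℕ}
    (I : Ideal (MvPolynomial (Fin n) K)) (hI : I ≠ ⊥) :
    maxIdeal K n • (⊤ : Submodule (MvPolynomial (Fin n) K) I) < ⊤ := by
  have hm := isMaximal_maxIdeal K n
  rw [lt_top_iff_ne_top]
  intro h
  obtain ⟨r, hr, hr0⟩ := exists_notMem_smul_eq_zero (E := I) (maxIdeal K n)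
    (maxIdeal K n).one_notMem fun e => by rw [h]; trivial
  obtain ⟨f, hf, hf0⟩ := Submodule.exists_mem_ne_zero_of_ne_bot hI
  have := congrArg Subtype.val (hr0 ⟨f, hf⟩)
  rcases mul_eq_zero.1 this with h0 | h0
  · exact hr (h0 ▸ zero_mem _)
  · exact hf0 h0

lemma exists_smul_ext_quotient_variables_eq_zero {K : Type} [Field K] {n : ℕ}
    (I : Ideal (MvPolynomial (Fin n) K)) (hI : I ≠ ⊥) (rs : List (MvPolynomial (Fin n) K))
    (hrs : ∀ r ∈ rs, r ∈ maxIdeal K n) (reg : IsRegular I rs) (W : Finset (Fin n)) (i : ℕ)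
    (hi : i + Wᶜ.card < rs.length) :
    ∃ s ∉ maxIdeal K n, ∀ e : Ext (ModuleCat.of (MvPolynomial (Fin n) K)
      (MvPolynomial (Fin n) K ⧸ Ideal.span (X (R := K) '' (W : Set (Fin n)))))
      (ModuleCat.of (MvPolynomial (Fin n) K) I) i, s • e = 0 := by
  have hm := isMaximal_maxIdeal K n
  have hspan : (Ideal.ofList (W.toList.map (X (R := K))) • ⊤ : Ideal (MvPolynomial (Fin n) K)) =
      Ideal.span (X '' (W : Set (Fin n))) := by
    rw [smul_eq_mul, Ideal.mul_top, Ideal.ofList]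
    congr 1
    ext p
    simp
  have hreg := isWeaklyRegular_map_X (K := K) (W.toList ++ Wᶜ.toList)
    (by
      rw [List.nodup_append]
      refine ⟨W.nodup_toList, Wᶜ.nodup_toList, fun a ha b hb hab => ?_⟩
      rw [Finset.mem_toList] at ha hb
      exact Finset.mem_compl.1 hb (hab ▸ ha))
  rw [List.map_append, isWeaklyRegular_append_iff, hspan] at hreg
  have hvar : ∀ y ∈ Wᶜ.toList.map (X (R := K)), y ∈ maxIdeal K n := by
    simp only [List.mem_map, forall_exists_index, and_imp]
    rintro _ j - rfl
    exact Ideal.subset_span ⟨j, rfl⟩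
  refine exists_smul_ext_eq_zero (maxIdeal K n) (ModuleCat.of _ I) (maxIdeal_smul_top_lt I hI) rs
    hrs reg (Wᶜ.toList.map X) hvar (ModuleCat.of _ _) hreg.2 ?_ i (by simpa using hi)
  rw [Module.support_eq_zeroLocus]
  refine PrimeSpectrum.zeroLocus_anti_mono ?_
  refine Ideal.span_le.2 ?_
  rintro _ ⟨j, rfl⟩
  rw [SetLike.mem_coe, Module.mem_annihilator]
  intro z
  obtain ⟨z, rfl⟩ := Submodule.mkQ_surjective _ z
  rw [← map_smul]
  refine (Submodule.Quotient.mk_eq_zero _).2 ?_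
  by_cases hj : j ∈ W
  · obtain ⟨z, rfl⟩ := Submodule.mkQ_surjective _ z
    rw [← map_smul]
    convert Submodule.zero_mem _
    refine (Submodule.Quotient.mk_eq_zero _).2 ?_
    exact Ideal.mul_mem_right _ _ (Ideal.subset_span ⟨j, hj, rfl⟩)
  · refine Submodule.smul_mem_smul (Ideal.subset_span ?_) trivial
    simpa using hj

/-- An element of `S` outside `I`, even locally at the graded maximal ideal, which is multiplied
into `I` by the variables in `W` bounds the length of an `I`-regular sequence. -/
lemma length_le_of_X_mul_mem {K : Type} [Field K] {n : ℕ}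
    (I : Ideal (MvPolynomial (Fin n) K)) (hI : I ≠ ⊥) (rs : List (MvPolynomial (Fin n) K))
    (hrs : ∀ r ∈ rs, r ∈ maxIdeal K n) (reg : IsRegular I rs) (W : Finset (Fin n))
    (hW : W.Nonempty) (w : MvPolynomial (Fin n) K) (hw : ∀ i ∈ W, X i * w ∈ I)
    (hloc : ∀ s ∉ maxIdeal K n, s * w ∉ I) : rs.length ≤ Wᶜ.card + 1 := by
  by_contra! hlen
  obtain ⟨s, hs, hs0⟩ := exists_smul_ext_quotient_variables_eq_zero I hI rs hrs reg W 1
    (by omega)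
  refine hloc s hs ?_
  have hle : Ideal.span (X (R := K) '' (W : Set (Fin n))) ≤
      LinearMap.ker (I.mkQ ∘ₗ LinearMap.toSpanSingleton (MvPolynomial (Fin n) K) _ w) := by
    rw [Ideal.span_le]
    rintro _ ⟨j, hj, rfl⟩
    exact (Submodule.Quotient.mk_eq_zero _).2 (hw j hj)
  let N := ModuleCat.of (MvPolynomial (Fin n) K)
    (MvPolynomial (Fin n) K ⧸ Ideal.span (X (R := K) '' (W : Set (Fin n))))
  let A := ModuleCat.of (MvPolynomial (Fin n) K) (MvPolynomial (Fin n) K)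
  let B := ModuleCat.of (MvPolynomial (Fin n) K) (MvPolynomial (Fin n) K ⧸ I)
  let g : A ⟶ B := ModuleCat.ofHom I.mkQ
  let φ : N ⟶ B := ModuleCat.ofHom (Submodule.liftQ _ _ hle)
  have hex : (ModuleCat.shortComplexOfCompEqZero I.subtype I.mkQ
      (by ext x; exact Ideal.Quotient.eq_zero_iff_mem.2 x.2)).ShortExact :=
    { exact := ModuleCat.shortComplex_exact _ (LinearMap.exact_subtype_mkQ I)
      mono_f := (ModuleCat.mono_iff_injective _).2 I.subtype_injective
      epi_g := (ModuleCat.epi_iff_surjective _).2 I.mkQ_surjective }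
  obtain ⟨e, he⟩ : ∃ e : Ext N A 0, e.comp (Ext.mk₀ g) (add_zero 0) = Ext.mk₀ (s • φ) :=
    Ext.covariant_sequence_exact₃ N hex (Ext.mk₀ (s • φ)) (zero_add 1)
      ((congrArg (fun e : Ext N B 0 => e.comp hex.extClass (zero_add 1)) (Ext.mk₀_smul s φ)).trans
        ((Ext.smul_comp _ _ _ _).trans (hs0 _)))
  obtain ⟨ψ, rfl⟩ := (Ext.mk₀_bijective N A).2 e
  rw [Ext.mk₀_comp_mk₀] at he
  have hψ : ψ ≫ g = s • φ := (Ext.mk₀_bijective N B).1 he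
  obtain ⟨j, hj⟩ := hW
  have hone : ψ.hom (Submodule.Quotient.mk 1) = (0 : MvPolynomial (Fin n) K) := by
    have h : (X j : MvPolynomial (Fin n) K) * ψ.hom (Submodule.Quotient.mk 1) = 0 := by
      refine (ψ.hom.map_smul (X j) (Submodule.Quotient.mk 1)).symm.trans ?_
      refine (congrArg ψ.hom ((Submodule.Quotient.mk_eq_zero _).2 ?_)).trans ψ.hom.map_zero
      exact Ideal.mul_mem_right _ _ (Ideal.subset_span ⟨j, hj, rfl⟩)
    exact (mul_eq_zero.1 h).resolve_left (X_ne_zero j)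
  have hw1 := LinearMap.congr_fun (congrArg ModuleCat.Hom.hom hψ) (Submodule.Quotient.mk 1)
  have hw2 : s • I.mkQ ((1 : MvPolynomial (Fin n) K) • w) = 0 :=
    hw1.symm.trans ((congrArg I.mkQ hone).trans (map_zero _))
  rw [one_smul, ← map_smul] at hw2
  exact (Submodule.Quotient.mk_eq_zero I).1 hw2

lemma length_le_card {K : Type} [Field K] {n : ℕ}
    (I : Ideal (MvPolynomial (Fin n) K)) (hI : I ≠ ⊥) (rs : List (MvPolynomial (Fin n) K))
    (hrs : ∀ r ∈ rs, r ∈ maxIdeal K n) (reg : IsRegular I rs) : rs.length ≤ n := by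
  by_contra! hlen
  obtain ⟨s, hs, hs0⟩ := exists_smul_ext_quotient_variables_eq_zero I hI rs hrs reg ∅ 0
    (by simpa using hlen)
  obtain ⟨f, hf, hf0⟩ := Submodule.exists_mem_ne_zero_of_ne_bot hI
  have hle : Ideal.span (X (R := K) '' ((∅ : Finset (Fin n)) : Set (Fin n))) ≤
      LinearMap.ker (LinearMap.toSpanSingleton (MvPolynomial (Fin n) K) I ⟨f, hf⟩) := by
    simp
  have h := hs0 (Ext.mk₀ (ModuleCat.ofHom (Submodule.liftQ _ _ hle)))
  rw [← Ext.mk₀_smul, Ext.mk₀_eq_zero_iff] at h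
  have h1 : s * (1 * f) = 0 := congrArg Subtype.val
    (LinearMap.congr_fun (congrArg ModuleCat.Hom.hom h) (Submodule.Quotient.mk 1))
  rw [one_mul] at h1
  rcases mul_eq_zero.1 h1 with h0 | h0
  · exact hs (h0 ▸ zero_mem _)
  · exact hf0 h0

end RegularSequences

section SquarefreeStable

variable {n : ℕ}

/-- In a stable upward closed family of sets, each member has an initial segment which is minimal
in the family. -/
lemma exists_initial_minimal {F : Finset (Fin n) → Prop} (hup : ∀ s t, s ⊆ t → F s → F t)
    (hst : ∀ s, F s → ∀ j ∈ s, (∀ l ∈ s, l ≤ j) → ∀ i < j, i ∉ s → F (insert i (s.erase j)))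
    {s : Finset (Fin n)} (hs : F s) :
    ∃ u, Minimal F u ∧ u ⊆ s ∧ ∀ a ∈ s, ∀ b ∈ u, a < b → a ∈ u := by
  obtain ⟨u, ⟨hu, hus, hini⟩, hmin⟩ := exists_minimal_of_wellFoundedLT
    (fun u => F u ∧ u ⊆ s ∧ ∀ a ∈ s, ∀ b ∈ u, a < b → a ∈ u) ⟨s, hs, subset_rfl, fun a ha _ _ _ => ha⟩
  refine ⟨u, ⟨hu, fun v hv hvu => ?_⟩, hus, hini⟩
  by_contra hn
  obtain ⟨j, hju, hjv⟩ := Finset.not_subset.1 hn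
  obtain ⟨m, hmu, hm⟩ := u.exists_maximalFor id ⟨j, hju⟩
  have hm : ∀ l ∈ u, l ≤ m := fun l hl => (le_total l m).elim id fun h => hm hl h
  have key : F (u.erase m) := by
    by_cases hmv : m ∈ v
    · have hjm : j < m := lt_of_le_of_ne (hm j hju) fun h => hjv (h ▸ hmv)
      refine hup _ _ ?_ (hst v hv m hmv (fun l hl => hm l (hvu hl)) j hjm hjv)
      exact Finset.insert_subset (Finset.mem_erase.2 ⟨hjm.ne, hju⟩) (Finset.erase_subset_erase _ hvu)
    · exact hup _ _ (Finset.subset_erase.2 ⟨hvu, hmv⟩) hv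
  refine Finset.notMem_erase m u (hmin ⟨key, (Finset.erase_subset _ _).trans hus, ?_⟩
    (Finset.erase_subset _ _) hmu)
  intro a ha b hb hab
  have hb := Finset.mem_of_mem_erase hb
  exact Finset.mem_erase.2 ⟨(hab.trans_le (hm b hb)).ne, hini a ha b hb hab⟩

lemma eq_of_initial_minimal {F : Finset (Fin n) → Prop} {s u v : Finset (Fin n)}
    (hu : Minimal F u) (hus : u ⊆ s) (hui : ∀ a ∈ s, ∀ b ∈ u, a < b → a ∈ u)
    (hv : Minimal F v) (hvs : v ⊆ s) (hvi : ∀ a ∈ s, ∀ b ∈ v, a < b → a ∈ v) : u = v := by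
  by_cases h : u ⊆ v
  · exact hv.eq_of_le hu.prop h
  · obtain ⟨x, hxu, hxv⟩ := Finset.not_subset.1 h
    refine (hu.eq_of_le hv.prop fun y hy => ?_).symm
    rcases lt_trichotomy x y with hxy | rfl | hxy
    · exact (hxv (hvi x (hus hxu) y hy hxy)).elim
    · exact hxu
    · exact hui y (hvs hy) x hxu hxy

/-- The exponent vector of the squarefree monomial with support `s`. -/
def sqfreeExp (s : Finset (Fin n)) : Fin n →₀ ℕ := Finsupp.indicator s fun _ _ => 1

lemma sqfreeExp_apply (s : Finset (Fin n)) (i : Fin n) :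
    sqfreeExp s i = if i ∈ s then 1 else 0 := by
  simp [sqfreeExp, Finsupp.indicator_apply]

lemma sqfreeExp_le_iff (s : Finset (Fin n)) (a : Fin n →₀ ℕ) :
    sqfreeExp s ≤ a ↔ s ⊆ a.support := by
  simp only [Finsupp.le_def, sqfreeExp_apply, Finset.subset_iff, Finsupp.mem_support_iff]
  refine forall_congr' fun i => ?_
  split_ifs with h <;> simp [h, Nat.one_le_iff_ne_zero]

lemma sqfreeExp_insert {s : Finset (Fin n)} {i : Fin n} (hi : i ∉ s) :
    sqfreeExp (insert i s) = Finsupp.single i 1 + sqfreeExp s := by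
  ext j
  simp only [Finsupp.add_apply, sqfreeExp_apply, Finsupp.single_apply, Finset.mem_insert]
  by_cases h : i = j
  · subst h; simp [hi]
  · simp [h, Ne.symm h]

/-- The variables multiplying the minimal generator with support `u` in the Stanley decomposition
of a squarefree stable ideal. -/
def coneVars (u : Finset (Fin n)) : Finset (Fin n) :=
  Finset.univ.filter fun j => j ∈ u ∨ ∀ l ∈ u, l < j

lemma mem_cone_sqfreeExp_iff (u : Finset (Fin n)) (a : Fin n →₀ ℕ) :
    a ∈ cone (sqfreeExp u) (coneVars u) ↔
      u ⊆ a.support ∧ ∀ i ∈ a.support, ∀ b ∈ u, i < b → i ∈ u := by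
  refine and_congr (sqfreeExp_le_iff u a) ⟨fun h i hi b hb hib => ?_, fun h j hj => ?_⟩
  · by_contra hiu
    refine Finsupp.mem_support_iff.1 hi ((h i ?_).trans (by simp [sqfreeExp_apply, hiu]))
    simp only [coneVars, Finset.mem_filter, Finset.mem_univ, true_and, not_or, not_forall]
    exact ⟨hiu, b, hb, hib.not_gt⟩
  · simp only [coneVars, Finset.mem_filter, Finset.mem_univ, true_and, not_or, not_forall,
      not_lt] at hj
    obtain ⟨hju, l, hl, hjl⟩ := hj
    rw [sqfreeExp_apply, if_neg hju]
    by_contra hne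
    exact hju (h j (Finsupp.mem_support_iff.2 hne) l hl (lt_of_le_of_ne hjl fun e => hju (e ▸ hl)))

variable {K : Type} [Field K] {I : Ideal (MvPolynomial (Fin n) K)}

lemma mem_expSet_of_le {a b : Fin n →₀ ℕ} (ha : a ∈ expSet I) (hab : a ≤ b) : b ∈ expSet I := by
  have h : monomial (b - a) (1 : K) * monomial a 1 ∈ I := I.mul_mem_left _ ha
  rwa [monomial_mul, one_mul, tsub_add_cancel_of_le hab] at h

lemma IsSqfreeMonomialIdeal.mem_expSet_of_mem_support (hI : IsSqfreeMonomialIdeal I)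
    {p : MvPolynomial (Fin n) K} (hp : p ∈ I) {a : Fin n →₀ ℕ} (ha : a ∈ p.support) :
    a ∈ expSet I := by
  obtain ⟨G, -, rfl⟩ := hI
  obtain ⟨g, hg, hga⟩ := mem_ideal_span_monomial_image.1 hp a ha
  exact mem_expSet_of_le (Ideal.subset_span ⟨g, hg, rfl⟩) hga

lemma IsSqfreeMonomialIdeal.mem_expSet_iff (hI : IsSqfreeMonomialIdeal I) (a : Fin n →₀ ℕ) :
    a ∈ expSet I ↔ sqfreeExp a.support ∈ expSet I := by
  refine ⟨fun ha => ?_, fun ha => mem_expSet_of_le ha ((sqfreeExp_le_iff _ _).2 subset_rfl)⟩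
  obtain ⟨G, hG, rfl⟩ := hI
  obtain ⟨g, hg, hga⟩ := mem_ideal_span_monomial_image.1 ha a (by simp [mem_support_iff])
  refine mem_expSet_of_le (Ideal.subset_span ⟨g, hg, rfl⟩) fun i => ?_
  rw [sqfreeExp_apply]
  split_ifs with hi
  · exact hG g hg i
  · exact (hga i).trans (by simpa using hi)

lemma IsSqfreeStable.insert_erase_mem (hI : IsSqfreeStable I) {s : Finset (Fin n)}
    (hs : sqfreeExp s ∈ expSet I) {j : Fin n} (hj : j ∈ s) (hmax : ∀ l ∈ s, l ≤ j) {i : Fin n}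
    (hij : i < j) (hi : i ∉ s) : sqfreeExp (insert i (s.erase j)) ∈ expSet I := by
  have h := hI.2 (sqfreeExp s) (fun l => by rw [sqfreeExp_apply]; split_ifs <;> simp) hs j
    (by simp [sqfreeExp_apply, hj])
    (fun l hl => by simpa [sqfreeExp_apply] using fun h => hl.not_ge (hmax l h)) i hij
    (by simp [sqfreeExp_apply, hi])
  have hs : sqfreeExp s = Finsupp.single j 1 + sqfreeExp (s.erase j) := by
    rw [← sqfreeExp_insert (Finset.notMem_erase j s), Finset.insert_erase hj]
  rwa [hs, add_assoc, add_tsub_cancel_left, add_comm,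
    ← sqfreeExp_insert (fun h => hi (Finset.mem_of_mem_erase h))] at h

lemma IsSqfreeStable.length_le_card_coneVars (hst : IsSqfreeStable I) (hI : I ≠ ⊥)
    {rs : List (MvPolynomial (Fin n) K)} (hrs : ∀ r ∈ rs, r ∈ maxIdeal K n)
    (reg : RingTheory.Sequence.IsRegular I rs) {u : Finset (Fin n)}
    (hu : Minimal (fun s => sqfreeExp s ∈ expSet I) u) : rs.length ≤ (coneVars u).card := by
  rcases u.eq_empty_or_nonempty with rfl | hne
  · simpa [coneVars] using length_le_card I hI rs hrs reg
  obtain ⟨m, hmu, hm⟩ := u.exists_maximalFor id hne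
  have hm : ∀ l ∈ u, l ≤ m := fun l hl => (le_total l m).elim id fun h => hm hl h
  have hmZ : m ∈ coneVars u := by simp [coneVars, hmu]
  have hmW : m ∉ (coneVars u)ᶜ := by simpa using hmZ
  refine (length_le_of_X_mul_mem I hI rs hrs reg (insert m (coneVars u)ᶜ)
    (Finset.insert_nonempty _ _) (monomial (sqfreeExp (u.erase m)) 1) (fun i hi => ?_)
    fun s hs hsI => ?_).trans ?_
  · have hiu : i ∉ u.erase m ∧ sqfreeExp (insert i (u.erase m)) ∈ expSet I := by
      rcases Finset.mem_insert.1 hi with rfl | hi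
      · exact ⟨Finset.notMem_erase _ _, by rw [Finset.insert_erase hmu]; exact hu.prop⟩
      · simp only [coneVars, Finset.mem_compl, Finset.mem_filter, Finset.mem_univ, true_and,
          not_or, not_forall, not_lt] at hi
        obtain ⟨hiu, l, hl, hil⟩ := hi
        refine ⟨fun h => hiu (Finset.mem_of_mem_erase h),
          hst.insert_erase_mem hu.prop hmu hm (lt_of_le_of_ne (hil.trans (hm l hl)) ?_) hiu⟩
        rintro rfl
        exact hiu hmu
    rw [X, monomial_mul, one_mul, ← sqfreeExp_insert hiu.1]
    exact hiu.2
  · refine Finset.notMem_erase m u (hu.le_of_le (hst.1.mem_expSet_of_mem_support hsI ?_)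
      (Finset.erase_subset m u) hmu)
    rw [mem_support_iff, coeff_mul_monomial', if_pos le_rfl, tsub_self, mul_one]
    exact coeff_zero_ne_zero_of_notMem_maxIdeal hs
  · rw [Finset.compl_insert, compl_compl, Finset.card_erase_add_one hmZ]

lemma IsSqfreeStable.stanleyPartN (hst : IsSqfreeStable I) {k : ℕ}
    (hk : ∀ u, Minimal (fun s => sqfreeExp s ∈ expSet I) u → k ≤ (coneVars u).card) :
    StanleyPartN (expSet I) k := by
  refine ⟨{u : Finset (Fin n) // Minimal (fun s => sqfreeExp s ∈ expSet I) u},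
    Fintype.ofFinite _, fun u => sqfreeExp u.1, fun u => coneVars u.1, fun u => hk u.1 u.2,
    fun u a ha => mem_expSet_of_le u.2.prop ha.1, fun a ha => ?_⟩
  obtain ⟨u, hu, hua⟩ := exists_initial_minimal (F := fun s => sqfreeExp s ∈ expSet I)
    (fun s t hst hs => mem_expSet_of_le hs ((sqfreeExp_le_iff _ _).2 fun i hi => by
      simpa [sqfreeExp_apply] using hst hi))
    (fun s hs j hj hmax i hij hi => hst.insert_erase_mem hs hj hmax hij hi)
    ((hst.1.mem_expSet_iff a).1 ha)
  refine ⟨⟨u, hu⟩, (mem_cone_sqfreeExp_iff u a).2 hua, fun v hv => ?_⟩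
  obtain ⟨hv1, hv2⟩ := (mem_cone_sqfreeExp_iff v.1 a).1 hv
  exact Subtype.ext (eq_of_initial_minimal v.2 hv1 hv2 hu hua.1 hua.2)

end SquarefreeStable

/-- Theorem `sqf_st`. The Stanley conjecture holds for squarefree stable
ideals: if `I ⊂ S = K[x_1,…,x_n]` is a nonzero squarefree stable monomial ideal, then
`sdepth_n(I) ≥ depth(I)`. -/
theorem sdepthN_ge_depth_of_sqfreeStable {K : Type} [Field K] {n : ℕ}
    (I : Ideal (MvPolynomial (Fin n) K)) (hst : IsSqfreeStable I) (hI : I ≠ ⊥) :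
    mdepth K n ↥I ≤ sdepthN (expSet I) := by
  refine sSup_le ?_
  rintro _ ⟨rs, hrs, reg, rfl⟩
  exact le_sSup ⟨rs.length, hst.stanleyPartN fun _ hu =>
    hst.length_le_card_coneVars hI hrs reg hu, rfl⟩
end
end
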